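/- Let q be a 2way-determined query that does not admit a fork-tripath, let κ = l^l and k = 2^{2κ+1} + κ − 1. Then for every database D: D ⊨ certain(q) if and only if (∅ ∈ Δ_k(q,D) or H(D,q) admits no matching saturating the set of blocks of D). -/

import Mathlib

/- Consistent query answering framework: a single relation symbol of arity `n`
   whose first `l` positions form the primary key. Facts are `Fin n → Elem`,
   atoms are `Fin n → Var`. -/

namespace CQA

/-- Key-equality: the tuples of the first `l` entries coincide. -/
def keyEq (l : ℕ) {n : ℕ} {α : Type*} (s t : Fin n → α) : Prop :=
  ∀ i : Fin n, (i : ℕ) < l → s i = t i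

/-- The set of entries occurring in the first `l` (key) positions of a tuple. -/
def keySet (l : ℕ) {n : ℕ} {α : Type*} (t : Fin n → α) : Set α :=
  {x | ∃ i : Fin n, (i : ℕ) < l ∧ t i = x}

/-- The set of all entries of a tuple. -/
def varsSet {n : ℕ} {α : Type*} (t : Fin n → α) : Set α :=
  Set.range t

/-- A (two-atom, Boolean, self-join) query `q = AB` is a pair of atoms. -/
abbrev Query (n : ℕ) (Var : Type*) := (Fin n → Var) × (Fin n → Var)

variable {n : ℕ} {Elem Var : Type*}

/-- The pair of facts `(a, b)` matches the two atoms of `q` via a single assignment `μ`. -/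
def solPair (q : Query n Var) (a b : Fin n → Elem) : Prop :=
  ∃ μ : Var → Elem, (∀ i, μ (q.1 i) = a i) ∧ (∀ i, μ (q.2 i) = b i)

/-- `D ⊨ q(ab)` : `(a,b)` is a solution to `q` in `D`. -/
def Sol (q : Query n Var) (D : Set (Fin n → Elem)) (a b : Fin n → Elem) : Prop :=
  a ∈ D ∧ b ∈ D ∧ solPair q a b

/-- `D ⊨ q{ab}` : `(a,b)` or `(b,a)` is a solution to `q` in `D`. -/
def SolSym (q : Query n Var) (D : Set (Fin n → Elem)) (a b : Fin n → Elem) : Prop :=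
  Sol q D a b ∨ Sol q D b a

/-- The set `q(D)` of solutions to `q` in `D`. -/
def solSet (q : Query n Var) (D : Set (Fin n → Elem)) :
    Set ((Fin n → Elem) × (Fin n → Elem)) :=
  {p | Sol q D p.1 p.2}

/-- `D ⊨ q` : some solution to `q` exists in `D`. -/
def Sat (q : Query n Var) (D : Set (Fin n → Elem)) : Prop :=
  ∃ a b, Sol q D a b

/-- A database is consistent if it contains no two distinct key-equal facts. -/
def Consistent (l : ℕ) (D : Set (Fin n → Elem)) : Prop :=
  ∀ a ∈ D, ∀ b ∈ D, keyEq l a b → a = b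

/-- `r` is a repair of `D` : a maximal consistent subset of `D`. -/
def Repair (l : ℕ) (D r : Set (Fin n → Elem)) : Prop :=
  r ⊆ D ∧ Consistent l r ∧ ∀ s, r ⊆ s → s ⊆ D → Consistent l s → s = r

/-- `D ⊨ certain(q)` : all repairs of `D` satisfy `q`. -/
def Certain (l : ℕ) (q : Query n Var) (D : Set (Fin n → Elem)) : Prop :=
  ∀ r, Repair l D r → Sat q r

/-- The block of the fact `a` in `D`: all facts of `D` key-equal to `a`. -/
def Block (l : ℕ) (D : Set (Fin n → Elem)) (a : Fin n → Elem) : Set (Fin n → Elem) :=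
  {b ∈ D | keyEq l a b}

/-- A `k`-set of `D`: at most `k` facts of `D`, at most one from each block. -/
def kSet (l k : ℕ) (D S : Set (Fin n → Elem)) : Prop :=
  S ⊆ D ∧ S.Finite ∧ S.ncard ≤ k ∧ Consistent l S

/-- A collection `𝒮` of sets of facts is closed under the two rules defining `Δ_k(q,D)`:
  (i) every `k`-set satisfying `q` is in `𝒮`, and (ii) if for a `k`-set `S` there is
  a block of `D` each of whose facts `u` admits a subset `S' ⊆ S ∪ {u}` that is a
  `k`-set belonging to `𝒮`, then `S ∈ 𝒮`. -/
def DeltaClosed (l k : ℕ) (q : Query n Var) (D : Set (Fin n → Elem))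
    (𝒮 : Set (Set (Fin n → Elem))) : Prop :=
  (∀ S, kSet l k D S → Sat q S → S ∈ 𝒮) ∧
  (∀ S, kSet l k D S → (∃ x ∈ D, ∀ u ∈ D, keyEq l x u →
      ∃ S', S' ⊆ S ∪ {u} ∧ kSet l k D S' ∧ S' ∈ 𝒮) → S ∈ 𝒮)

/-- `Δ_k(q,D)`: the least collection of `k`-sets of `D` closed under the two rules
(the intersection of all closed collections). -/
def Delta (l k : ℕ) (q : Query n Var) (D : Set (Fin n → Elem)) :
    Set (Set (Fin n → Elem)) :=
  ⋂₀ {𝒮 | DeltaClosed l k q D 𝒮}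

/-- `q = AB` is 2way-determined. -/
def TwoWayDet (l : ℕ) (q : Query n Var) : Prop :=
  ¬ keySet l q.1 ⊆ keySet l q.2 ∧ ¬ keySet l q.2 ⊆ keySet l q.1 ∧
  keySet l q.1 ⊆ varsSet q.2 ∧ keySet l q.2 ⊆ varsSet q.1

/-- The zig-zag property of a query `q`, relative to databases over `Elem`. -/
def ZigZag (l : ℕ) (q : Query n Var) (Elem : Type*) : Prop :=
  ∀ D : Set (Fin n → Elem), D.Finite →
    ∀ a b b' c : Fin n → Elem, a ∈ D → b ∈ D → b' ∈ D → c ∈ D →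
      ¬ keyEq l a c → a ≠ b → keyEq l b b' →
      Sol q D a b → Sol q D c b' → Sol q D a b'

/-- `rkey(a, r)`: facts of `r` whose key entries are included in those of `a`. -/
def rkey (l : ℕ) (r : Set (Fin n → Elem)) (a : Fin n → Elem) : Set (Fin n → Elem) :=
  {c ∈ r | keySet l c ⊆ keySet l a}

open Classical in
/-- `g(e)`, the set of entries of the tuple `g̅(e)`, for `e` branching with `d, f`. -/
noncomputable def gSet (l : ℕ) (d e f : Fin n → Elem) : Set Elem :=
  if keySet l d ⊆ keySet l e ∧ ¬ keySet l f ⊆ keySet l e then keySet l d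
  else if ¬ keySet l d ⊆ keySet l e ∧ keySet l f ⊆ keySet l e then keySet l f
  else if keySet l d ⊆ keySet l f ∧ keySet l f ⊆ keySet l e then keySet l d
  else if keySet l f ⊆ keySet l d ∧ keySet l d ⊆ keySet l e then keySet l f
  else keySet l e

/-- A tripath of `q`: a database `Θ`, each of whose blocks has at most two facts,
whose blocks (indexed by `Fin m`) are arranged as a rooted tree with exactly one root
block and exactly two leaf blocks; the root block has the single fact `a(root)`, leaf
blocks have the single fact `b(leaf)`, all other blocks have exactly the two facts
`a(B) ≠ b(B)`; if `B` is the parent of `B'` then `Θ ⊨ q{a(B) b(B')}`; the (unique)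
branching block `B` with its two children `B', B''` gives the center `d e f` =
`b(B') a(B) b(B'')` with `(d,e)` and `(e,f)` distinct solutions; and `g(e)` is not
included in the key of the root fact nor of either leaf fact. -/
structure Tripath (l : ℕ) (q : Query n Var) (Θ : Set (Fin n → Elem)) where
  finite : Θ.Finite
  m : ℕ
  blk : Fin m → Set (Fin n → Elem)
  blk_is_block : ∀ i, ∃ x ∈ Θ, blk i = Block l Θ x
  blk_cover : Θ = ⋃ i, blk i
  blk_inj : Function.Injective blk
  blk_card : ∀ i, (blk i).ncard ≤ 2
  parent : Fin m → Option (Fin m)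
  root : Fin m
  parent_root : parent root = none
  parent_ne_root : ∀ i, i ≠ root → ∃ j, parent i = some j
  reach_root : ∀ i, Relation.ReflTransGen (fun x y => parent x = some y) i root
  leaf1 : Fin m
  leaf2 : Fin m
  leaf_ne : leaf1 ≠ leaf2
  leaf1_leaf : ∀ j, parent j ≠ some leaf1
  leaf2_leaf : ∀ j, parent j ≠ some leaf2
  leaves_eq : ∀ i, (∀ j, parent j ≠ some i) → i = leaf1 ∨ i = leaf2
  aFact : Fin m → (Fin n → Elem)
  bFact : Fin m → (Fin n → Elem)
  root_blk : blk root = {aFact root}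
  leaf1_blk : blk leaf1 = {bFact leaf1}
  leaf2_blk : blk leaf2 = {bFact leaf2}
  other_blk : ∀ i, i ≠ root → i ≠ leaf1 → i ≠ leaf2 →
    aFact i ≠ bFact i ∧ blk i = {aFact i, bFact i}
  adj_sol : ∀ i j, parent j = some i → SolSym q Θ (aFact i) (bFact j)
  branch : Fin m
  child1 : Fin m
  child2 : Fin m
  child_ne : child1 ≠ child2
  parent_child1 : parent child1 = some branch
  parent_child2 : parent child2 = some branch
  center_sol1 : Sol q Θ (bFact child1) (aFact branch)
  center_sol2 : Sol q Θ (aFact branch) (bFact child2)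
  center_distinct : (bFact child1, aFact branch) ≠ (aFact branch, bFact child2)
  g_root : ¬ gSet l (bFact child1) (aFact branch) (bFact child2) ⊆ keySet l (aFact root)
  g_leaf1 : ¬ gSet l (bFact child1) (aFact branch) (bFact child2) ⊆ keySet l (bFact leaf1)
  g_leaf2 : ¬ gSet l (bFact child1) (aFact branch) (bFact child2) ⊆ keySet l (bFact leaf2)

namespace Tripath

variable {l : ℕ} {q : Query n Var} {Θ : Set (Fin n → Elem)}

/-- The fact `d` of the center `def` of a tripath. -/
def dc (T : Tripath l q Θ) : Fin n → Elem := T.bFact T.child1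
/-- The fact `e` of the center `def` of a tripath. -/
def ec (T : Tripath l q Θ) : Fin n → Elem := T.aFact T.branch
/-- The fact `f` of the center `def` of a tripath. -/
def fc (T : Tripath l q Θ) : Fin n → Elem := T.bFact T.child2
/-- The root fact `u₀` of a tripath. -/
def u0 (T : Tripath l q Θ) : Fin n → Elem := T.aFact T.root
/-- The leaf fact `u₁` of a tripath. -/
def u1 (T : Tripath l q Θ) : Fin n → Elem := T.bFact T.leaf1
/-- The leaf fact `u₂` of a tripath. -/
def u2 (T : Tripath l q Θ) : Fin n → Elem := T.bFact T.leaf2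

/-- The center of the tripath is a fork (`(f,d)` is not a solution). -/
def IsFork (T : Tripath l q Θ) : Prop := ¬ Sol q Θ T.fc T.dc

/-- The center of the tripath is a triangle (`(f,d)` is a solution). -/
def IsTriangle (T : Tripath l q Θ) : Prop := Sol q Θ T.fc T.dc

/-- Variable-niceness witnessed by the elements `x, y, z`. -/
def VariableNiceWith (T : Tripath l q Θ) (x y z : Elem) : Prop :=
  x ∈ keySet l T.dc ∧ y ∈ keySet l T.ec ∧ z ∈ keySet l T.fc ∧
  ({x, y, z} : Set Elem) ∩ (keySet l T.u0 ∪ keySet l T.u1 ∪ keySet l T.u2) = ∅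

/-- The tripath is variable-nice. -/
def VariableNice (T : Tripath l q Θ) : Prop := ∃ x y z, T.VariableNiceWith x y z

/-- The tripath is solution-nice: the only solutions to `q` in `Θ` are those between a
parent block and a child block, plus possibly `(f, d)`. -/
def SolutionNice (T : Tripath l q Θ) : Prop :=
  ∀ a b, Sol q Θ a b →
    (∃ i j, T.parent j = some i ∧
      ((a = T.aFact i ∧ b = T.bFact j) ∨ (a = T.bFact j ∧ b = T.aFact i)))
    ∨ (a = T.fc ∧ b = T.dc)

/-- The tripath is nice. -/
def Nice (T : Tripath l q Θ) : Prop :=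
  (∃ x y z : Elem, T.VariableNiceWith x y z ∧
    ∃ w ∈ ({x, y, z} : Set Elem),
      ∀ c ∈ Θ, c ≠ T.u0 → c ≠ T.u1 → c ≠ T.u2 → w ∈ keySet l c) ∧
  T.SolutionNice ∧
  (∀ u ∈ ({T.u0, T.u1, T.u2} : Set (Fin n → Elem)),
    ∃ w ∈ keySet l u, ∀ c ∈ Θ, c ≠ u → w ∉ keySet l c)

end Tripath

/-- `D` contains a tripath of `q`: some subset of `D` is a tripath of `q`. -/
def ContainsTripath (l : ℕ) (q : Query n Var) (D : Set (Fin n → Elem)) : Prop :=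
  ∃ Θ ⊆ D, Nonempty (Tripath l q Θ)

/-- `q` admits a fork-tripath (over databases with elements in `Elem`). -/
def AdmitsForkTripath (l : ℕ) (q : Query n Var) (Elem : Type*) : Prop :=
  ∃ D : Set (Fin n → Elem), D.Finite ∧ ∃ Θ ⊆ D, ∃ T : Tripath l q Θ, T.IsFork

/-- `q` admits a triangle-tripath (over databases with elements in `Elem`). -/
def AdmitsTriangleTripath (l : ℕ) (q : Query n Var) (Elem : Type*) : Prop :=
  ∃ D : Set (Fin n → Elem), D.Finite ∧ ∃ Θ ⊆ D, ∃ T : Tripath l q Θ, T.IsTriangle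

/-- `q` admits a tripath (over databases with elements in `Elem`). -/
def AdmitsTripath (l : ℕ) (q : Query n Var) (Elem : Type*) : Prop :=
  ∃ D : Set (Fin n → Elem), D.Finite ∧ ContainsTripath l q D

/-- Edges of the solution graph `G(D,q)`: distinct facts `a, b` of `D` with `D ⊨ q{ab}`. -/
def gEdge (q : Query n Var) (D : Set (Fin n → Elem)) (a b : Fin n → Elem) : Prop :=
  a ≠ b ∧ a ∈ D ∧ b ∈ D ∧ SolSym q D a b

/-- The connected component of the fact `a` in the solution graph `G(D,q)`. -/
def gComp (q : Query n Var) (D : Set (Fin n → Elem)) (a : Fin n → Elem) :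
    Set (Fin n → Elem) :=
  {b ∈ D | Relation.ReflTransGen (gEdge q D) a b}

/-- `C` is a quasi-clique (of the solution graph of `D`): any two non-key-equal facts of
`C` are joined by an edge. -/
def QuasiClique (l : ℕ) (q : Query n Var) (D : Set (Fin n → Elem))
    (C : Set (Fin n → Elem)) : Prop :=
  ∀ a ∈ C, ∀ b ∈ C, ¬ keyEq l a b → SolSym q D a b

open Classical in
/-- `clique(a)`: the connected component of `a` in `G(D,q)` if it is a quasi-clique, and
`{a}` otherwise. -/
noncomputable def cliqueOf (l : ℕ) (q : Query n Var) (D : Set (Fin n → Elem))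
    (a : Fin n → Elem) : Set (Fin n → Elem) :=
  if QuasiClique l q D (gComp q D a) then gComp q D a else {a}

/-- Edges of the bipartite graph `H(D,q)`: between a block `B` of `D` and a set `c` of
the form `clique(y)`, when `B` contains a fact `a ∈ c` with `(a,a)` not a solution. -/
def HEdge (l : ℕ) (q : Query n Var) (D : Set (Fin n → Elem))
    (B c : Set (Fin n → Elem)) : Prop :=
  (∃ x ∈ D, B = Block l D x) ∧ (∃ y ∈ D, c = cliqueOf l q D y) ∧
  ∃ a ∈ B, a ∈ c ∧ ¬ Sol q D a a

/-- `H(D,q)` admits a matching saturating the set `V₁` of blocks of `D`: an injective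
assignment of an `H`-edge to every block. -/
def SaturatingMatching (l : ℕ) (q : Query n Var) (D : Set (Fin n → Elem)) : Prop :=
  ∃ M : Set (Fin n → Elem) → Set (Fin n → Elem),
    (∀ x ∈ D, HEdge l q D (Block l D x) (M (Block l D x))) ∧
    (∀ x ∈ D, ∀ y ∈ D, M (Block l D x) = M (Block l D y) → Block l D x = Block l D y)

/-- `D` is a clique-database for `q`: every connected component of `G(D,q)` is a
quasi-clique. -/
def CliqueDB (l : ℕ) (q : Query n Var) (D : Set (Fin n → Elem)) : Prop :=
  ∀ a ∈ D, QuasiClique l q D (gComp q D a)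

/-- `q` is a clique-query: every database (over `Elem`) is a clique-database for `q`. -/
def CliqueQuery (l : ℕ) (q : Query n Var) (Elem : Type*) : Prop :=
  ∀ D : Set (Fin n → Elem), D.Finite → CliqueDB l q D

/-- One step of `q`-connectedness between (the blocks of) two facts of `D`:
either they are in the same block, or some fact of the block of `x` and some fact
of the block of `y` form a solution. -/
def qConnRel (l : ℕ) (q : Query n Var) (D : Set (Fin n → Elem))
    (x y : Fin n → Elem) : Prop :=
  keyEq l x y ∨ ∃ a b, a ∈ Block l D x ∧ b ∈ Block l D y ∧ SolSym q D a b

/-- The blocks of `x` and of `y` are `q`-connected in `D`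
(reflexive-symmetric-transitive closure). -/
def qConn (l : ℕ) (q : Query n Var) (D : Set (Fin n → Elem))
    (x y : Fin n → Elem) : Prop :=
  Relation.EqvGen (qConnRel l q D) x y

/-- The `q`-connected component of (the block of) the fact `x` in `D`. -/
def qComponent (l : ℕ) (q : Query n Var) (D : Set (Fin n → Elem))
    (x : Fin n → Elem) : Set (Fin n → Elem) :=
  {y ∈ D | qConn l q D x y}

end CQA

namespace CQAP
open CQA
variable {n l : ℕ} {Elem Var : Type}

theorem keyEq_refl (a : Fin n → Elem) : keyEq l a a := fun _ _ => rfl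
theorem keyEq_symm {a b : Fin n → Elem} (h : keyEq l a b) : keyEq l b a := fun i hi => (h i hi).symm
theorem keyEq_trans {a b c : Fin n → Elem} (h : keyEq l a b) (h' : keyEq l b c) : keyEq l a c :=
  fun i hi => (h i hi).trans (h' i hi)

theorem keySet_congr {a b : Fin n → Elem} (h : keyEq l a b) : keySet l a = keySet l b := by
  ext x; constructor
  · rintro ⟨i, hi, rfl⟩; exact ⟨i, hi, (h i hi).symm⟩
  · rintro ⟨i, hi, rfl⟩; exact ⟨i, hi, h i hi⟩

/-- conflict -/
def cf (q : Query n Var) (a b : Fin n → Elem) : Prop := solPair q a b ∨ solPair q b a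

theorem cf_symm {q : Query n Var} {a b : Fin n → Elem} (h : cf q a b) : cf q b a := h.symm

theorem det_out {q : Query n Var} (hq : TwoWayDet l q) {a b b' : Fin n → Elem}
    (h : solPair q a b) (h' : solPair q a b') : keyEq l b b' := by
  obtain ⟨μ, h1, h2⟩ := h
  obtain ⟨μ', h1', h2'⟩ := h'
  intro i hi
  obtain ⟨j, hj⟩ := hq.2.2.2 ⟨i, hi, rfl⟩
  rw [← h2, ← h2', ← hj, h1, h1']

theorem det_in {q : Query n Var} (hq : TwoWayDet l q) {a b b' : Fin n → Elem}
    (h : solPair q b a) (h' : solPair q b' a) : keyEq l b b' := by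
  obtain ⟨μ, h1, h2⟩ := h
  obtain ⟨μ', h1', h2'⟩ := h'
  intro i hi
  obtain ⟨j, hj⟩ := hq.2.2.1 ⟨i, hi, rfl⟩
  rw [← h1, ← h1', ← hj, h2, h2']

theorem zz {q : Query n Var} {a b c d : Fin n → Elem}
    (h1 : solPair q a b) (h2 : solPair q c b) (h3 : solPair q c d) : solPair q a d := by
  classical
  obtain ⟨μ1, a1, b1⟩ := h1
  obtain ⟨μ2, a2, b2⟩ := h2
  obtain ⟨μ3, a3, b3⟩ := h3
  refine ⟨fun v => if v ∈ Set.range q.1 then μ1 v else μ3 v, fun i => ?_, fun i => ?_⟩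
  · simp [a1]
  · by_cases h : q.2 i ∈ Set.range q.1
    · simp only [h, if_true]
      obtain ⟨j, hj⟩ := h
      rw [b1, ← b2, ← hj, a2, ← a3, hj, b3]
    · simp only [h, if_false, b3]

theorem gSet_cases (d e f : Fin n → Elem) :
    gSet l d e f = keySet l d ∨ gSet l d e f = keySet l e ∨ gSet l d e f = keySet l f := by
  unfold gSet; split_ifs <;> simp

theorem gSet_sub (d e f : Fin n → Elem) : gSet l d e f ⊆ keySet l e := by
  unfold gSet; split_ifs with h1 h2 h3 h4
  · exact h1.1
  · exact h2.2
  · exact h3.1.trans h3.2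
  · exact h4.1.trans h4.2
  · exact subset_rfl

theorem gSet_congr {d d' e f f' : Fin n → Elem} (h : keyEq l d d') (h' : keyEq l f f') :
    gSet l d e f = gSet l d' e f' := by
  unfold gSet; rw [keySet_congr h, keySet_congr h']

/-- if one of the three keys is contained in the three keys, `g` is contained in it -/
theorem gSet_min {d e f : Fin n → Elem} {S : Set Elem}
    (hS : S = keySet l d ∨ S = keySet l e ∨ S = keySet l f)
    (h1 : S ⊆ keySet l d) (h2 : S ⊆ keySet l e) (h3 : S ⊆ keySet l f) : gSet l d e f ⊆ S := by
  rcases hS with rfl | rfl | rfl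
  · unfold gSet; split_ifs with a b c d
    · exact subset_rfl
    · exact absurd h2 b.1
    · exact subset_rfl
    · exact d.1
    · exfalso; apply c; refine ⟨h3, ?_⟩; by_contra hh; exact a ⟨h2, hh⟩
  · exact gSet_sub _ _ _
  · unfold gSet; split_ifs with a b c d
    · exact absurd h2 a.2
    · exact subset_rfl
    · exact c.1
    · exact subset_rfl
    · exfalso; apply d; refine ⟨h1, ?_⟩; by_contra hh; exact b ⟨hh, h2⟩

end CQAP

namespace CQAP
open CQA
variable {n l : ℕ} {Elem Var : Type}

abbrev Nd (m : Fin 3 → ℕ) := {x : Fin 3 × ℕ // x.2 ≤ m x.1}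

instance ndFinite (m : Fin 3 → ℕ) : Finite (Nd m) := by
  have : Set.Finite {x : Fin 3 × ℕ | x.2 ≤ m x.1} := by
    apply Set.Finite.subset (Set.Finite.prod (Set.finite_univ (α := Fin 3))
      (Set.finite_Iic (m 0 + m 1 + m 2)))
    rintro ⟨a, j⟩ h
    simp only [Set.mem_ofPred_eq] at h
    simp only [Set.mem_prod, Set.mem_univ, Set.mem_Iic, true_and]
    fin_cases a <;> simp at h <;> omega
  exact this.to_subtype

open Classical in
noncomputable def ndPar {m : Fin 3 → ℕ} (x : Nd m) : Option (Nd m) :=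
  if x.1.1 = 0 then
    (if h : x.1.2 + 1 ≤ m 0 then some ⟨(0, x.1.2 + 1), h⟩ else none)
  else some (if x.1.2 = 0 then ⟨(0, 0), Nat.zero_le _⟩ else ⟨(x.1.1, x.1.2 - 1), (Nat.sub_le _ _).trans x.2⟩)

theorem ndPar_iff {m : Fin 3 → ℕ} (x y : Nd m) : ndPar x = some y ↔
    (x.1.1 = 0 ∧ y.1.1 = 0 ∧ y.1.2 = x.1.2 + 1) ∨ (x.1.1 ≠ 0 ∧ x.1.2 = 0 ∧ y.1.1 = 0 ∧ y.1.2 = 0) ∨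
    (x.1.1 ≠ 0 ∧ y.1.1 = x.1.1 ∧ x.1.2 = y.1.2 + 1) := by
  obtain ⟨⟨a, i⟩, hx⟩ := x
  obtain ⟨⟨b, j⟩, hy⟩ := y
  simp only at hx hy
  unfold ndPar
  by_cases ha : a = 0
  · subst ha
    simp only [if_true]
    split_ifs with h
    · simp only [Option.some.injEq, Subtype.mk.injEq, Prod.mk.injEq]
      constructor
      · rintro ⟨rfl, rfl⟩; simp
      · rintro (⟨-, rfl, rfl⟩ | ⟨h, _⟩ | ⟨h, _⟩)
        · simp
        · exact absurd rfl h
        · exact absurd rfl h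
    · constructor
      · intro h; cases h
      · rintro (⟨-, rfl, rfl⟩ | ⟨h, _⟩ | ⟨h, _⟩)
        · omega
        · exact absurd rfl h
        · exact absurd rfl h
  · simp only [ha, if_false]
    rcases Nat.eq_zero_or_pos i with hi | hi
    · subst hi
      simp only [if_true, Option.some.injEq, Subtype.mk.injEq, Prod.mk.injEq]
      constructor
      · rintro ⟨rfl, rfl⟩; right; left; simp [ha]
      · rintro (h | h | h)
        · exact h.1.elim
        · exact ⟨h.2.2.1.symm, h.2.2.2.symm⟩
        · omega
    · have : i ≠ 0 := by omega
      simp only [this, if_false, Option.some.injEq, Subtype.mk.injEq, Prod.mk.injEq]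
      constructor
      · rintro ⟨rfl, rfl⟩; right; right; refine ⟨ha, rfl, by omega⟩
      · rintro (h | h | h)
        · exact h.1.elim
        · exact h.2.1.elim
        · exact ⟨h.2.1.symm, by omega⟩

/-- the underlying set -/
def thetaSet (m : Fin 3 → ℕ) (X Y : Fin 3 → ℕ → Fin n → Elem) : Set (Fin n → Elem) :=
  {x | ∃ α j, j ≤ m α ∧ (x = Y α j ∨ (j < m α ∧ x = X α j))}

theorem mkTripath {q : Query n Var} (m : Fin 3 → ℕ) (X Y : Fin 3 → ℕ → Fin n → Elem)
    (hk : ∀ α j, j < m α → keyEq l (X α j) (Y α j))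
    (hne : ∀ α j, j < m α → X α j ≠ Y α j)
    (hcf : ∀ α j, j < m α → cf q (X α j) (Y α (j+1)))
    (hinj : ∀ α j β i, j ≤ m α → i ≤ m β → keyEq l (Y α j) (Y β i) → α = β ∧ j = i)
    (hde : solPair q (Y 1 0) (Y 0 0)) (hef : solPair q (Y 0 0) (Y 2 0))
    (hg : ∀ α, ¬ gSet l (Y 1 0) (Y 0 0) (Y 2 0) ⊆ keySet l (Y α (m α))) :
    ∃ T : Tripath l q (thetaSet m X Y), T.dc = Y 1 0 ∧ T.ec = Y 0 0 ∧ T.fc = Y 2 0 := by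
  classical
  obtain ⟨N, ⟨E⟩⟩ := Finite.exists_equiv_fin (Nd m)
  set F : Fin N ≃ Nd m := E.symm with hF
  let blk : Nd m → Set (Fin n → Elem) := fun x => {y | y = Y x.1.1 x.1.2 ∨ (x.1.2 < m x.1.1 ∧ y = X x.1.1 x.1.2)}
  let aF : Nd m → Fin n → Elem := fun x => if x.1.1 = 0 then Y x.1.1 x.1.2 else X x.1.1 x.1.2
  let bF : Nd m → Fin n → Elem := fun x => if x.1.1 = 0 then X x.1.1 x.1.2 else Y x.1.1 x.1.2
  let nd : (α : Fin 3) → Nd m := fun α => ⟨(α, m α), le_rfl⟩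
  let n0 : (α : Fin 3) → Nd m := fun α => ⟨(α, 0), Nat.zero_le _⟩
  have hYT : ∀ α j, j ≤ m α → Y α j ∈ thetaSet m X Y := fun α j h => ⟨α, j, h, Or.inl rfl⟩
  have hXT : ∀ α j, j < m α → X α j ∈ thetaSet m X Y := fun α j h => ⟨α, j, h.le, Or.inr ⟨h, rfl⟩⟩
  have hblk : ∀ x : Nd m, blk x = Block l (thetaSet m X Y) (Y x.1.1 x.1.2) := by
    rintro ⟨⟨α, j⟩, hx⟩
    simp only at hx
    ext y
    constructor
    · rintro (rfl | ⟨h, rfl⟩)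
      · exact ⟨hYT _ _ hx, keyEq_refl _⟩
      · exact ⟨hXT _ _ h, keyEq_symm (hk _ _ h)⟩
    · rintro ⟨⟨β, i, hi, rfl | ⟨h, rfl⟩⟩, hy⟩
      · obtain ⟨rfl, rfl⟩ := hinj _ _ _ _ hx hi hy
        exact Or.inl rfl
      · obtain ⟨rfl, rfl⟩ := hinj _ _ _ _ hx hi (keyEq_trans hy (hk _ _ h))
        exact Or.inr ⟨h, rfl⟩
  have hbi : Function.Injective blk := by
    rintro ⟨⟨α, j⟩, hx⟩ ⟨⟨β, i⟩, hy⟩ h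
    have h1 : Y β i ∈ blk ⟨⟨α, j⟩, hx⟩ := by rw [h]; exact Or.inl rfl
    rw [hblk] at h1
    obtain ⟨rfl, rfl⟩ := hinj _ _ _ _ hx hy h1.2
    rfl
  have hpar : ∀ x y : Fin N, (ndPar (F x)).map F.symm = some y ↔ ndPar (F x) = some (F y) := by
    intro x y
    rw [Option.map_eq_some_iff]
    constructor
    · rintro ⟨a, h, rfl⟩; simpa using h
    · intro h; exact ⟨_, h, by simp⟩
  have hendblk : ∀ α, blk (nd α) = {Y α (m α)} := by
    intro α; ext y; simp [blk, nd]
  have hreach0 : ∀ j (hj : j ≤ m 0), Relation.ReflTransGen (fun x y : Nd m => ndPar x = some y) ⟨(0, j), hj⟩ (nd 0) := by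
    intro j hj
    obtain ⟨t, ht⟩ : ∃ t, m 0 = j + t := ⟨m 0 - j, by omega⟩
    induction t generalizing j with
    | zero => 
      have : j = m 0 := by omega
      subst this; exact Relation.ReflTransGen.refl
    | succ t ih =>
      refine Relation.ReflTransGen.head ?_ (ih (j+1) (by omega) (by omega))
      rw [ndPar_iff]; simp
  have hreach : ∀ x : Nd m, Relation.ReflTransGen (fun x y : Nd m => ndPar x = some y) x (nd 0) := by
    rintro ⟨⟨α, j⟩, hj⟩
    by_cases hα : α = 0
    · subst hα; exact hreach0 _ _
    · induction j with
      | zero =>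
        refine Relation.ReflTransGen.head ?_ (hreach0 0 (Nat.zero_le _))
        rw [ndPar_iff]; simp [hα]
      | succ j ih =>
        refine Relation.ReflTransGen.head ?_ (ih (by simp only at hj ⊢; omega))
        rw [ndPar_iff]; simp [hα]
  have hleaf : ∀ α : Fin 3, α ≠ 0 → ∀ x : Nd m, ndPar x ≠ some (nd α) := by
    rintro α hα ⟨⟨β, j⟩, hj⟩ h
    rw [ndPar_iff] at h
    simp only [nd] at h hj
    rcases h with h | h | h
    · exact hα h.2.1
    · exact hα h.2.2.1
    · obtain ⟨h1, h2, h3⟩ := h; subst h2; omega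
  refine ⟨{
    finite := ?_
    m := N
    blk := fun i => blk (F i)
    blk_is_block := fun i => ⟨_, hYT _ _ (F i).2, hblk _⟩
    blk_cover := ?_
    blk_inj := hbi.comp F.injective
    blk_card := ?_
    parent := fun i => (ndPar (F i)).map F.symm
    root := F.symm (nd 0)
    parent_root := ?_
    parent_ne_root := ?_
    reach_root := ?_
    leaf1 := F.symm (nd 1)
    leaf2 := F.symm (nd 2)
    leaf_ne := ?_
    leaf1_leaf := ?_
    leaf2_leaf := ?_
    leaves_eq := ?_
    aFact := fun i => aF (F i)
    bFact := fun i => bF (F i)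
    root_blk := ?_
    leaf1_blk := ?_
    leaf2_blk := ?_
    other_blk := ?_
    adj_sol := ?_
    branch := F.symm (n0 0)
    child1 := F.symm (n0 1)
    child2 := F.symm (n0 2)
    child_ne := ?_
    parent_child1 := ?_
    parent_child2 := ?_
    center_sol1 := ?_
    center_sol2 := ?_
    center_distinct := ?_
    g_root := ?_
    g_leaf1 := ?_
    g_leaf2 := ?_ }, ?_⟩
  · have : thetaSet m X Y ⊆ ⋃ x : Nd m, {Y x.1.1 x.1.2, X x.1.1 x.1.2} := by
      rintro y ⟨α, j, hj, h⟩
      refine Set.mem_iUnion.2 ⟨⟨(α, j), hj⟩, ?_⟩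
      rcases h with h | h
      · exact Or.inl h
      · exact Or.inr h.2
    exact Set.Finite.subset (Set.finite_iUnion fun _ => by simp) this
  · ext y; constructor
    · rintro ⟨α, j, hj, h⟩
      refine Set.mem_iUnion.2 ⟨F.symm ⟨(α, j), hj⟩, ?_⟩
      simpa [blk] using h
    · intro h
      obtain ⟨i, hi⟩ := Set.mem_iUnion.1 h
      exact ⟨_, _, (F i).2, hi⟩
  · intro i
    have : blk (F i) ⊆ {Y (F i).1.1 (F i).1.2, X (F i).1.1 (F i).1.2} := by
      rintro y (h | h)
      · exact Or.inl h
      · exact Or.inr h.2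
    exact (Set.ncard_le_ncard this (by simp)).trans ((Set.ncard_insert_le _ _).trans (by simp))
  · simp [ndPar, nd]
  · intro i hi
    have hi' : F i ≠ nd 0 := fun h => hi (by rw [← h]; simp)
    simp only [hpar]
    unfold ndPar
    by_cases h0 : (F i).1.1 = 0
    · simp only [h0, if_true]
      have : (F i).1.2 + 1 ≤ m 0 := by
        have h2 := (F i).2
        rw [h0] at h2
        rcases Nat.lt_or_ge (F i).1.2 (m 0) with h3 | h3
        · exact h3
        · exact absurd (Subtype.ext (Prod.ext h0 (le_antisymm h2 h3))) hi'
      simp only [this, dite_true]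
      exact ⟨F.symm ⟨(0, _), this⟩, by simp⟩
    · simp only [h0, if_false]
      exact ⟨F.symm _, by rw [F.apply_symm_apply]⟩
  · intro i
    have := Relation.ReflTransGen.lift (p := fun x y : Fin N => (ndPar (F x)).map F.symm = some y) F.symm (fun a b (hab : ndPar a = some b) => by simp [Function.onFun, hab]) _ _ (hreach (F i))
    simpa [Function.onFun] using this
  · simp [nd]
  · intro j; simp only [ne_eq, hpar, F.apply_symm_apply]; exact hleaf 1 (by decide) _
  · intro j; simp only [ne_eq, hpar, F.apply_symm_apply]; exact hleaf 2 (by decide) _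
  · intro i hi
    by_contra hcon
    push Not at hcon
    simp only [ne_eq, hpar] at hi
    have hi2 : ∀ x : Nd m, ndPar x ≠ some (F i) := fun x => by simpa using hi (F.symm x)
    by_cases h0 : (F i).1.1 = 0
    · rcases Nat.eq_zero_or_pos (F i).1.2 with h | h
      · apply hi2 (n0 1); rw [ndPar_iff]; right; left; exact ⟨by simp [n0], rfl, h0, h⟩
      · have h2 := (F i).2
        rw [h0] at h2
        apply hi2 ⟨(0, (F i).1.2 - 1), by simp only; omega⟩
        rw [ndPar_iff]; left; refine ⟨rfl, h0, ?_⟩; simp only; omega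
    · have h2 := (F i).2
      have h3 : (F i).1.2 < m (F i).1.1 := by
        refine lt_of_le_of_ne h2 fun h3 => ?_
        have h4 : F i = nd (F i).1.1 := Subtype.ext (Prod.ext rfl h3)
        have h5 : (F i).1.1 = 1 ∨ (F i).1.1 = 2 := by
          generalize (F i).1.1 = z at h0; fin_cases z <;> simp at h0 ⊢
        rcases h5 with h5 | h5
        · apply hcon.1; rw [← h5, ← h4]; simp
        · apply hcon.2; rw [← h5, ← h4]; simp
      apply hi2 ⟨((F i).1.1, (F i).1.2 + 1), h3⟩
      rw [ndPar_iff]; right; right; exact ⟨h0, rfl, rfl⟩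
  · simp only [F.apply_symm_apply]; rw [hendblk]; simp [aF, nd]
  · simp only [F.apply_symm_apply]; rw [hendblk]; simp [bF, nd]
  · simp only [F.apply_symm_apply]; rw [hendblk]; simp [bF, nd]
  · intro i h0 h1 h2
    have h3 : (F i).1.2 < m (F i).1.1 := by
      refine lt_of_le_of_ne (F i).2 fun h3 => ?_
      have h4 : F i = nd (F i).1.1 := Subtype.ext (Prod.ext rfl h3)
      have h5 : (F i).1.1 = 0 ∨ (F i).1.1 = 1 ∨ (F i).1.1 = 2 := by
        generalize (F i).1.1 = z; fin_cases z <;> simp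
      rcases h5 with h5 | h5 | h5
      · apply h0; rw [← h5, ← h4]; simp
      · apply h1; rw [← h5, ← h4]; simp
      · apply h2; rw [← h5, ← h4]; simp
    have h6 := hne _ _ h3
    by_cases h7 : (F i).1.1 = 0
    · simp only [aF, bF, h7, if_true]
      rw [h7] at h6 h3
      refine ⟨h6.symm, ?_⟩
      ext y; simp [blk, h7, h3]
    · simp only [aF, bF, h7, if_false]
      refine ⟨h6, ?_⟩
      ext y; simp [blk, h3]; tauto
  · intro i j hij
    rw [hpar, ndPar_iff] at hij
    have hi := (F i).2
    have hj := (F j).2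
    rcases hij with ⟨h1, h2, h3⟩ | ⟨h1, h2, h3, h4⟩ | ⟨h1, h2, h3⟩
    · simp only [aF, bF, h1, h2, h3, if_true]
      rw [h2, h3] at hi
      have := hcf 0 (F j).1.2 (by omega)
      have ha := hYT _ _ hi
      have hb := hXT _ _ (show (F j).1.2 < m 0 by omega)
      rcases this with h | h
      · exact Or.inr ⟨hb, ha, h⟩
      · exact Or.inl ⟨ha, hb, h⟩
    · simp only [aF, bF, h1, h2, h3, h4, if_true, if_false]
      have h5 : (F j).1.1 = 1 ∨ (F j).1.1 = 2 := by
        generalize (F j).1.1 = z at h1; fin_cases z <;> simp at h1 ⊢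
      rcases h5 with h5 | h5
      · rw [h5]; exact Or.inr ⟨hYT _ _ (Nat.zero_le _), hYT _ _ (Nat.zero_le _), hde⟩
      · rw [h5]; exact Or.inl ⟨hYT _ _ (Nat.zero_le _), hYT _ _ (Nat.zero_le _), hef⟩
    · simp only [aF, bF, h1, h2, h3, if_false]
      rw [h3] at hj
      rcases hcf (F j).1.1 (F i).1.2 hj with h | h
      · exact Or.inl ⟨hXT _ _ hj, hYT _ _ hj, h⟩
      · exact Or.inr ⟨hYT _ _ hj, hXT _ _ hj, h⟩
  · simp [n0]
  · rw [hpar, ndPar_iff]; simp [n0]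
  · rw [hpar, ndPar_iff]; simp [n0]
  · simp only [F.apply_symm_apply]
    exact ⟨hYT _ _ (Nat.zero_le _), hYT _ _ (Nat.zero_le _), hde⟩
  · simp only [F.apply_symm_apply]
    exact ⟨hYT _ _ (Nat.zero_le _), hYT _ _ (Nat.zero_le _), hef⟩
  · simp only [F.apply_symm_apply, aF, bF, n0, if_true]
    intro h
    have h1 : Y 1 0 = Y 0 0 := (Prod.mk.inj h).1
    have := (hinj 1 0 0 0 (Nat.zero_le _) (Nat.zero_le _) (by rw [h1]; exact keyEq_refl _)).1
    exact absurd this (by decide)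
  · simp only [F.apply_symm_apply]; exact hg 0
  · simp only [F.apply_symm_apply]; exact hg 1
  · simp only [F.apply_symm_apply]; exact hg 2
  · simp [Tripath.dc, Tripath.ec, Tripath.fc, aF, bF, n0]

theorem thetaSet_sub {m : Fin 3 → ℕ} {X Y : Fin 3 → ℕ → Fin n → Elem} {C : Set (Fin n → Elem)}
    (hX : ∀ α j, j < m α → X α j ∈ C) (hY : ∀ α j, j ≤ m α → Y α j ∈ C) : thetaSet m X Y ⊆ C := by
  rintro y ⟨α, j, hj, rfl | ⟨h, rfl⟩⟩
  · exact hY _ _ hj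
  · exact hX _ _ h

end CQAP

namespace CQAP
open CQA
variable {n l : ℕ} {Elem Var : Type}

theorem repair_meets {D r : Set (Fin n → Elem)} (h : Repair l D r) {x : Fin n → Elem} (hx : x ∈ D) :
    ∃ u ∈ r, keyEq l x u := by
  by_contra hc
  push Not at hc
  have := h.2.2 (insert x r) (Set.subset_insert _ _) (Set.insert_subset hx h.1) (by
    rintro a (rfl | ha) b (rfl | hb) hab
    · rfl
    · exact absurd hab (hc b hb)
    · exact absurd (keyEq_symm hab) (hc a ha)
    · exact h.2.1 a ha b hb hab)
  exact hc x (this ▸ Set.mem_insert _ _) (keyEq_refl _)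

theorem repair_of {D r : Set (Fin n → Elem)} (h1 : r ⊆ D) (h2 : Consistent l r)
    (h3 : ∀ x ∈ D, ∃ u ∈ r, keyEq l x u) : Repair l D r := by
  refine ⟨h1, h2, fun s hrs hsD hs => subset_antisymm ?_ hrs⟩
  intro x hx
  obtain ⟨u, hu, hxu⟩ := h3 x (hsD hx)
  rw [hs x hx u (hrs hu) hxu]; exact hu

theorem delta_sound {k : ℕ} {q : Query n Var} {D : Set (Fin n → Elem)}
    (h : ∅ ∈ Delta l k q D) : Certain l q D := by
  have hc : DeltaClosed l k q D {S | ∀ r, Repair l D r → S ⊆ r → Sat q r} := by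
    constructor
    · rintro S - ⟨a, b, ha, hb, hs⟩ r hr hSr
      exact ⟨a, b, hSr ha, hSr hb, hs⟩
    · rintro S - ⟨x, hx, hu⟩ r hr hSr
      obtain ⟨u, hur, hxu⟩ := repair_meets hr hx
      obtain ⟨S', hS', -, hh⟩ := hu u (hr.1 hur) hxu
      exact hh r hr (hS'.trans (Set.union_subset hSr (by simpa using hur)))
  intro r hr
  exact h _ hc r hr (Set.empty_subset _)

theorem mem_cliqueOf {q : Query n Var} {D : Set (Fin n → Elem)} {a : Fin n → Elem} (ha : a ∈ D) :
    a ∈ cliqueOf l q D a := by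
  unfold cliqueOf
  split_ifs
  · exact ⟨ha, Relation.ReflTransGen.refl⟩
  · rfl

theorem block_congr {D : Set (Fin n → Elem)} {a b : Fin n → Elem} (h : keyEq l a b) :
    Block l D a = Block l D b := by
  ext x; exact ⟨fun hx => ⟨hx.1, keyEq_trans (keyEq_symm h) hx.2⟩, fun hx => ⟨hx.1, keyEq_trans h hx.2⟩⟩

theorem matching_sound {q : Query n Var} {D : Set (Fin n → Elem)}
    (h : ¬ SaturatingMatching l q D) : Certain l q D := by
  classical
  intro r hr
  by_contra hs
  apply h
  have hex : ∀ x, ∃ a, x ∈ D → a ∈ r ∧ keyEq l x a := by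
    intro x
    by_cases hx : x ∈ D
    · obtain ⟨u, h1, h2⟩ := repair_meets hr hx; exact ⟨u, fun _ => ⟨h1, h2⟩⟩
    · exact ⟨x, fun h => absurd h hx⟩
  have hex2 : ∀ B : Set (Fin n → Elem), ∃ a : Fin n → Elem, (∃ a ∈ r, a ∈ B) → a ∈ r ∧ a ∈ B := by
    intro B
    by_cases hB : ∃ a ∈ r, a ∈ B
    · obtain ⟨a, ha⟩ := hB; exact ⟨a, fun _ => ha⟩
    · by_cases hE : Nonempty (Fin n → Elem)
      · exact ⟨hE.some, fun h => absurd h hB⟩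
      · obtain ⟨a, ha⟩ | hno := em (∃ a : Fin n → Elem, True)
        · exact absurd ⟨a⟩ hE
        · exfalso
          apply h
          refine ⟨fun _ => ∅, fun x _ => absurd ⟨x⟩ hE, fun x _ => absurd ⟨x⟩ hE⟩
  choose f hf using hex2
  have hf' : ∀ x ∈ D, f (Block l D x) ∈ r ∧ f (Block l D x) ∈ Block l D x := by
    intro x hx
    apply hf
    obtain ⟨u, h1, h2⟩ := repair_meets hr hx
    exact ⟨u, h1, hr.1 h1, h2⟩
  refine ⟨fun B => cliqueOf l q D (f B), ?_, ?_⟩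
  · intro x hx
    obtain ⟨h1, h2⟩ := hf' x hx
    refine ⟨⟨x, hx, rfl⟩, ⟨_, hr.1 h1, rfl⟩, _, h2, mem_cliqueOf (hr.1 h1), fun h3 => hs ⟨_, _, h1, h1, h3.2.2⟩⟩
  · intro x hx y hy hxy
    obtain ⟨h1, h2⟩ := hf' x hx
    obtain ⟨h3, h4⟩ := hf' y hy
    simp only at hxy
    have h5 : f (Block l D y) ∈ cliqueOf l q D (f (Block l D x)) := by
      rw [hxy]; exact mem_cliqueOf (hr.1 h3)
    have h6 : keyEq l (f (Block l D x)) (f (Block l D y)) := by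
      unfold cliqueOf at h5
      split_ifs at h5 with hqc
      · by_contra h7
        rcases hqc _ ⟨hr.1 h1, Relation.ReflTransGen.refl⟩ _ h5 h7 with h8 | h8
        · exact hs ⟨_, _, h1, h3, h8.2.2⟩
        · exact hs ⟨_, _, h3, h1, h8.2.2⟩
      · rw [h5]; exact keyEq_refl _
    apply block_congr
    exact keyEq_trans h2.2 (keyEq_trans h6 (keyEq_symm h4.2))

end CQAP

namespace CQAP
open CQA
variable {n l : ℕ} {Elem Var : Type}

def cov (l : ℕ) (S : Set (Fin n → Elem)) (x : Fin n → Elem) : Prop := ∃ b ∈ S, keyEq l x b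

theorem cov_congr {S : Set (Fin n → Elem)} {x y : Fin n → Elem} (h : keyEq l x y) (hy : cov l S y) : cov l S x := by
  obtain ⟨b, hb, h'⟩ := hy; exact ⟨b, hb, keyEq_trans h h'⟩

theorem cov_mono {S T : Set (Fin n → Elem)} (h : S ⊆ T) {x : Fin n → Elem} (hy : cov l S x) : cov l T x := by
  obtain ⟨b, hb, h'⟩ := hy; exact ⟨b, h hb, h'⟩

theorem sat_cf {q : Query n Var} {S : Set (Fin n → Elem)} {a b : Fin n → Elem} (ha : a ∈ S) (hb : b ∈ S)
    (h : cf q a b) : Sat q S := by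
  rcases h with h | h
  · exact ⟨a, b, ha, hb, h⟩
  · exact ⟨b, a, hb, ha, h⟩

/-- number of keys inside a key -/
theorem key_count {ι : Type} (S : Finset ι) (u : ι → Fin n → Elem) (y : Fin n → Elem)
    (h1 : ∀ s ∈ S, keySet l (u s) ⊆ keySet l y)
    (h2 : ∀ s ∈ S, ∀ t ∈ S, keyEq l (u s) (u t) → s = t) : S.card ≤ l ^ l := by
  classical
  have hch : ∀ s : ι, ∀ i : Fin l, ∃ j : Fin l, s ∈ S → ∀ hi : (i : ℕ) < n, ∃ hj : (j : ℕ) < n, y ⟨j, hj⟩ = u s ⟨i, hi⟩ := by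
    intro s i
    by_cases hs : s ∈ S
    · by_cases hi : (i : ℕ) < n
      · obtain ⟨j, hj, hj'⟩ := h1 s hs ⟨⟨i, hi⟩, i.2, rfl⟩
        exact ⟨⟨j, hj⟩, fun _ _ => ⟨j.2, hj'⟩⟩
      · exact ⟨i, fun _ h => absurd h hi⟩
    · exact ⟨i, fun h => absurd h hs⟩
  choose φ hφ using hch
  have : S.card ≤ (Finset.univ : Finset (Fin l → Fin l)).card := by
    apply Finset.card_le_card_of_injOn φ (fun _ _ => Finset.mem_coe.2 (Finset.mem_univ _))
    intro s hs t ht hst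
    apply h2 s hs t ht
    intro i hi
    obtain ⟨hj, e1⟩ := hφ s ⟨i, hi⟩ hs i.2
    obtain ⟨hj', e2⟩ := hφ t ⟨i, hi⟩ ht i.2
    have : (φ s ⟨i, hi⟩) = (φ t ⟨i, hi⟩) := by rw [hst]
    calc u s i = y ⟨φ s ⟨i, hi⟩, hj⟩ := e1.symm
      _ = y ⟨φ t ⟨i, hi⟩, hj'⟩ := by congr 2; rw [this]
      _ = u t i := e2
  simpa using this

structure Env (l : ℕ) (q : Query n Var) (k : ℕ) (C B K : Set (Fin n → Elem))
    (𝒢 : Set (Set (Fin n → Elem))) (a0 : Fin n → Elem) : Prop where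
  hC : C.Finite
  hq : TwoWayDet l q
  g1 : ∀ S ∈ 𝒢, ∀ T ⊆ S, T ∈ 𝒢
  g2 : ∀ S ∈ 𝒢, ¬ Sat q S
  g3 : ∀ S ∈ 𝒢, S.Finite → S.ncard < k → ∀ x ∈ C, ¬ cov l S x → ∃ u ∈ C, keyEq l x u ∧ insert u S ∈ 𝒢
  ntp : ∀ Θ ⊆ C, Tripath l q Θ → False
  BC : B ⊆ C
  cons : Consistent l B
  nsB : ¬ Sat q B
  KB : K ⊆ B
  clo : ∀ b ∈ B, b ∉ K → ∀ x ∈ C, cf q b x → cov l B x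
  a0K : a0 ∈ K
  esc : ∀ x ∈ C, keySet l x ⊆ keySet l a0 → cov l B x

def dirn (q : Query n Var) (b : Bool) (t w : Fin n → Elem) : Prop :=
  if b then solPair q t w else solPair q w t

theorem dirn_cf {q : Query n Var} {b : Bool} {t w : Fin n → Elem} (h : dirn q b t w) : cf q w t := by
  unfold dirn at h; split_ifs at h
  · exact Or.inr h
  · exact Or.inl h

theorem cf_dirn {q : Query n Var} {t w : Fin n → Elem} (h : cf q w t) : ∃ b, dirn q b t w := by
  rcases h with h | h
  · exact ⟨false, h⟩
  · exact ⟨true, h⟩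

theorem dirn_det {q : Query n Var} (hq : TwoWayDet l q) {b : Bool} {t t' w : Fin n → Elem}
    (h : dirn q b t w) (h' : dirn q b t' w) : keyEq l t t' := by
  cases b
  · exact det_out hq h h'
  · exact det_in hq h h'

abbrev img (V : Finset (List Bool)) (u : List Bool → Fin n → Elem) : Set (Fin n → Elem) := u '' (V : Set (List Bool))

def opn (l : ℕ) (q : Query n Var) (C B : Set (Fin n → Elem)) (V : Finset (List Bool))
    (u : List Bool → Fin n → Elem) (α : List Bool) : Prop :=
  α ∈ V ∧ ∃ x ∈ C, cf q (u α) x ∧ ¬ cov l (B ∪ img V u) x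

structure Pre (l : ℕ) (q : Query n Var) (C B K : Set (Fin n → Elem))
    (𝒢 : Set (Set (Fin n → Elem))) (a0 : Fin n → Elem) (V : Finset (List Bool))
    (u : List Bool → Fin n → Elem) (M : Set (Fin n → Elem)) : Prop where
  nil : [] ∈ V
  suf : ∀ b α, b :: α ∈ V → α ∈ V
  uC : ∀ α ∈ V, u α ∈ C
  unc : ∀ α ∈ V, ¬ cov l B (u α)
  inj : ∀ α ∈ V, ∀ β ∈ V, keyEq l (u α) (u β) → α = β
  tt : ∀ b α, b :: α ∈ V → ∃ t ∈ C, keyEq l t (u (b :: α)) ∧ dirn q b t (u α)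
  t0 : ∃ t ∈ C, keyEq l t (u []) ∧ cf q a0 t
  ns : ¬ Sat q (B ∪ img V u)
  MG : M ∈ 𝒢
  Mf : M.Finite
  KM : K ⊆ M
  OM : ∀ α, opn l q C B V u α → u α ∈ M

section
variable {q : Query n Var} {k : ℕ} {C B K : Set (Fin n → Elem)}
    {𝒢 : Set (Set (Fin n → Elem))} {a0 : Fin n → Elem}

/-- insertion of a new fact keeps solution-freeness -/
theorem ns_insert (E : Env l q k C B K 𝒢 a0) {S M : Set (Fin n → Elem)} {v : Fin n → Elem}
    (hv : v ∈ C) (hvB : ¬ cov l B v) (hS : ¬ Sat q (B ∪ S)) (hKM : K ⊆ M) (hM : insert v M ∈ 𝒢)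
    (hO : ∀ s ∈ S, cf q s v → s ∈ M) : ¬ Sat q (B ∪ insert v S) := by
  have key : ∀ s ∈ B ∪ insert v S, ¬ cf q s v := by
    rintro s (hs | rfl | hs) h
    · by_cases hK : s ∈ K
      · exact E.g2 _ hM (sat_cf (Set.mem_insert_of_mem _ (hKM hK)) (Set.mem_insert _ _) h)
      · exact hvB (E.clo s hs hK v hv h)
    · exact E.g2 _ hM (sat_cf (Set.mem_insert _ _) (Set.mem_insert _ _) h)
    · exact E.g2 _ hM (sat_cf (Set.mem_insert_of_mem _ (hO s hs h)) (Set.mem_insert _ _) h)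
  rintro ⟨a, b, ha, hb, hab⟩
  by_cases ha' : a = v
  · subst ha'; exact key b hb (Or.inr hab)
  by_cases hb' : b = v
  · subst hb'; exact key a ha (Or.inl hab)
  apply hS
  refine ⟨a, b, ?_, ?_, hab⟩
  · rcases ha with h | h | h
    · exact Or.inl h
    · exact absurd h ha'
    · exact Or.inr h
  · rcases hb with h | h | h
    · exact Or.inl h
    · exact absurd h hb'
    · exact Or.inr h

theorem pre_init (E : Env l q k C B K 𝒢 a0) (hKG : K ∈ 𝒢) (hKk : K.ncard < k)
    {z : Fin n → Elem} (hz : z ∈ C) (hcf : cf q a0 z) (hu : ¬ cov l B z) :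
    ∃ u M, Pre l q C B K 𝒢 a0 {[]} u M := by
  have hKf : K.Finite := E.hC.subset (E.KB.trans E.BC)
  obtain ⟨v, hv, hzv, hvG⟩ := E.g3 K hKG hKf hKk z hz (fun h => hu (cov_mono E.KB h))
  have hvB : ¬ cov l B v := fun h => hu (cov_congr hzv h)
  refine ⟨fun _ => v, insert v K, ?_⟩
  constructor
  · simp
  · simp
  · simpa using hv
  · simpa using hvB
  · simp
  · simp
  · exact ⟨z, hz, hzv, hcf⟩
  · have := ns_insert E (S := ∅) hv hvB (by simpa using E.nsB) subset_rfl hvG (by simp)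
    have hi : img {[]} (fun _ => v) = {v} := by simp [img]
    rw [hi]
    simpa using this
  · exact hvG
  · exact hKf.insert _
  · exact Set.subset_insert _ _
  · intro α _; exact Set.mem_insert _ _

theorem pre_ins (E : Env l q k C B K 𝒢 a0) {V : Finset (List Bool)} {u : List Bool → Fin n → Elem}
    {M : Set (Fin n → Elem)} (P : Pre l q C B K 𝒢 a0 V u M) (hk : M.ncard < k)
    {y : List Bool} {b : Bool} (hy : y ∈ V) (hby : b :: y ∉ V)
    {x : Fin n → Elem} (hx : x ∈ C) (hd : dirn q b x (u y)) (hunc : ¬ cov l (B ∪ img V u) x) :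
    ∃ u' M', Pre l q C B K 𝒢 a0 (insert (b :: y) V) u' M' ∧ (∀ α ∈ V, u' α = u α) ∧
      keyEq l x (u' (b :: y)) ∧ M'.ncard ≤ M.ncard + 1 := by
  classical
  have hMu : ¬ cov l M x ∨ True := Or.inr trivial
  -- use the subset of M consisting of K and open facts
  set M0 : Set (Fin n → Elem) := M ∩ (B ∪ img V u) with hM0
  have hM0G : M0 ∈ 𝒢 := E.g1 _ P.MG _ Set.inter_subset_left
  have hM0f : M0.Finite := P.Mf.subset Set.inter_subset_left
  have hM0c : M0.ncard ≤ M.ncard := Set.ncard_le_ncard Set.inter_subset_left P.Mf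
  obtain ⟨v, hv, hxv, hvG⟩ := E.g3 M0 hM0G hM0f (by omega) x hx
    (fun h => hunc (cov_mono Set.inter_subset_right h))
  have hvun : ¬ cov l (B ∪ img V u) v := fun h => hunc (cov_congr hxv h)
  have hvB : ¬ cov l B v := fun h => hvun (cov_mono Set.subset_union_left h)
  have hvV : ∀ α ∈ V, ¬ keyEq l (u α) v := fun α hα h =>
    hvun ⟨u α, Or.inr ⟨α, hα, rfl⟩, keyEq_symm h⟩
  set u' := Function.update u (b :: y) v with hu'
  have hold : ∀ α ∈ V, u' α = u α := by
    intro α hα; rw [hu', Function.update_of_ne]; rintro rfl; exact hby hα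
  have hnew : u' (b :: y) = v := by rw [hu', Function.update_self]
  have himg : img (insert (b :: y) V) u' = insert v (img V u) := by
    ext w; constructor
    · rintro ⟨α, hα, rfl⟩
      rw [Finset.mem_coe, Finset.mem_insert] at hα
      rcases hα with rfl | hα
      · rw [hnew]; exact Set.mem_insert _ _
      · rw [hold α hα]; exact Or.inr ⟨α, hα, rfl⟩
    · rintro (rfl | ⟨α, hα, rfl⟩)
      · exact ⟨b :: y, by simp, hnew⟩
      · exact ⟨α, by rw [Finset.mem_coe, Finset.mem_insert]; exact Or.inr hα, hold α hα⟩
  have hKM0 : K ⊆ M0 := fun a ha => ⟨P.KM ha, Or.inl (E.KB ha)⟩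
  refine ⟨u', insert v M0, ?_, hold, by rw [hnew]; exact hxv, (Set.ncard_insert_le _ _).trans (by omega)⟩
  constructor
  · exact Finset.mem_insert_of_mem P.nil
  · intro c α h
    rcases Finset.mem_insert.1 h with h | h
    · rw [(List.cons.inj h).2]; exact Finset.mem_insert_of_mem hy
    · exact Finset.mem_insert_of_mem (P.suf c α h)
  · intro α h
    rcases Finset.mem_insert.1 h with rfl | h
    · rwa [hnew]
    · rw [hold α h]; exact P.uC α h
  · intro α h
    rcases Finset.mem_insert.1 h with rfl | h
    · rwa [hnew]
    · rw [hold α h]; exact P.unc α h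
  · intro α hα β hβ h
    rcases Finset.mem_insert.1 hα with rfl | hα <;> rcases Finset.mem_insert.1 hβ with rfl | hβ
    · rfl
    · rw [hnew, hold β hβ] at h; exact absurd (keyEq_symm h) (hvV β hβ)
    · rw [hnew, hold α hα] at h; exact absurd h (hvV α hα)
    · rw [hold α hα, hold β hβ] at h; exact P.inj α hα β hβ h
  · intro c α h
    rcases Finset.mem_insert.1 h with h | h
    · obtain ⟨rfl, rfl⟩ := List.cons.inj h
      rw [hnew, hold α hy]
      exact ⟨x, hx, hxv, hd⟩
    · rw [hold _ h, hold α (P.suf c α h)]; exact P.tt c α h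
  · rw [hold _ P.nil]; exact P.t0
  · rw [himg]
    refine ns_insert E hv hvB P.ns hKM0 hvG ?_
    rintro s ⟨α, hα, rfl⟩ h
    exact ⟨P.OM α ⟨hα, v, hv, h, hvun⟩, Or.inr ⟨α, hα, rfl⟩⟩
  · exact hvG
  · exact hM0f.insert _
  · exact hKM0.trans (Set.subset_insert _ _)
  · rintro α ⟨hα, w, hw, h1, h2⟩
    rcases Finset.mem_insert.1 hα with rfl | hα
    · rw [hnew]; exact Set.mem_insert _ _
    · rw [hold α hα] at h1 ⊢
      refine Set.mem_insert_of_mem _ ⟨P.OM α ⟨hα, w, hw, h1, fun h => h2 ?_⟩, Or.inr ⟨α, hα, rfl⟩⟩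
      rw [himg]
      exact cov_mono (Set.union_subset_union_right _ (Set.subset_insert _ _)) h

theorem opn_mono {V V' : Finset (List Bool)} {u u' : List Bool → Fin n → Elem} (hV : V ⊆ V')
    (hu : ∀ α ∈ V, u' α = u α) {α : List Bool} (hα : α ∈ V) (h : opn l q C B V' u' α) : opn l q C B V u α := by
  obtain ⟨-, x, hx, h1, h2⟩ := h
  rw [hu α hα] at h1
  refine ⟨hα, x, hx, h1, fun h => h2 (cov_mono (Set.union_subset_union_right _ ?_) h)⟩
  rintro _ ⟨β, hβ, rfl⟩
  exact ⟨β, hV hβ, hu β hβ⟩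

/-- try to expand in one direction -/
theorem pre_dir (E : Env l q k C B K 𝒢 a0) {V : Finset (List Bool)} {u : List Bool → Fin n → Elem}
    {M : Set (Fin n → Elem)} (P : Pre l q C B K 𝒢 a0 V u M) (hk : M.ncard < k)
    {y : List Bool} (b : Bool) (hy : y ∈ V) (hby : b :: y ∉ V) :
    ∃ V' u' M', Pre l q C B K 𝒢 a0 V' u' M' ∧ V ⊆ V' ∧ V' ⊆ insert (b :: y) V ∧ (∀ α ∈ V, u' α = u α) ∧
      M'.ncard ≤ M.ncard + 1 ∧ (∀ x ∈ C, dirn q b x (u y) → cov l (B ∪ img V' u') x) := by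
  classical
  by_cases h : ∃ x ∈ C, dirn q b x (u y) ∧ ¬ cov l (B ∪ img V u) x
  · obtain ⟨x, hx, h1, h2⟩ := h
    obtain ⟨u', M', P', h3, h4, h5⟩ := pre_ins E P hk hy hby hx h1 h2
    refine ⟨_, u', M', P', Finset.subset_insert _ _, subset_rfl, h3, h5, ?_⟩
    intro x' hx' h1'
    refine ⟨u' (b :: y), Or.inr ⟨b :: y, by simp, rfl⟩, keyEq_trans (dirn_det E.hq h1' h1) h4⟩
  · push Not at h
    exact ⟨V, u, M, P, subset_rfl, Finset.subset_insert _ _, fun _ _ => rfl, by omega, h⟩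

end
end CQAP

namespace CQAP
open CQA
variable {n l : ℕ} {Elem Var : Type}

def act (l : ℕ) (q : Query n Var) (C B : Set (Fin n → Elem)) (V : Finset (List Bool))
    (u : List Bool → Fin n → Elem) (e : List Bool) : Prop :=
  ∀ b : Bool, ∃ o, opn l q C B V u o ∧ b :: e <:+ o

def GG (l : ℕ) (u : List Bool → Fin n → Elem) (e : List Bool) : Set Elem :=
  gSet l (u (true :: e)) (u e) (u (false :: e))

structure St (l : ℕ) (q : Query n Var) (C B K : Set (Fin n → Elem))
    (𝒢 : Set (Set (Fin n → Elem))) (a0 : Fin n → Elem) (V : Finset (List Bool))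
    (u : List Bool → Fin n → Elem) : Prop where
  pre : ∃ M, Pre l q C B K 𝒢 a0 V u M
  stab : ∀ b α, opn l q C B V u α → b :: α ∉ V
  J : ∀ o, opn l q C B V u o → ∀ e, e <:+ o → e ≠ o → act l q C B V u e → GG l u e ⊆ keySet l (u o.tail)

section
variable {q : Query n Var} {k : ℕ} {C B K : Set (Fin n → Elem)}
    {𝒢 : Set (Set (Fin n → Elem))} {a0 : Fin n → Elem}

theorem pre_shrink (E : Env l q k C B K 𝒢 a0) {V : Finset (List Bool)} {u : List Bool → Fin n → Elem}
    {M : Set (Fin n → Elem)} (P : Pre l q C B K 𝒢 a0 V u M) :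
    Pre l q C B K 𝒢 a0 V u (K ∪ u '' {α | opn l q C B V u α}) := by
  have hsub : (K ∪ u '' {α | opn l q C B V u α}) ⊆ M := by
    apply Set.union_subset P.KM
    rintro _ ⟨α, hα, rfl⟩; exact P.OM α hα
  exact { P with
    MG := E.g1 _ P.MG _ hsub
    Mf := P.Mf.subset hsub
    KM := Set.subset_union_left
    OM := fun α hα => Or.inr ⟨α, hα, rfl⟩ }

theorem suf_mem {V : Finset (List Bool)} (hs : ∀ b α, b :: α ∈ V → α ∈ V) {α β : List Bool}
    (h : α <:+ β) (hβ : β ∈ V) : α ∈ V := by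
  induction β with
  | nil => rw [List.suffix_nil.1 h]; exact hβ
  | cons b β ih =>
    rcases List.suffix_cons_iff.1 h with rfl | h
    · exact hβ
    · exact ih h (hs _ _ hβ)

theorem act_mem {V : Finset (List Bool)} {u : List Bool → Fin n → Elem} (hs : ∀ b α, b :: α ∈ V → α ∈ V)
    {e : List Bool} (h : act l q C B V u e) (b : Bool) : b :: e ∈ V := by
  obtain ⟨o, ho, h1⟩ := h b
  exact suf_mem hs h1 ho.1

theorem st_step (E : Env l q k C B K 𝒢 a0) {V : Finset (List Bool)} {u : List Bool → Fin n → Elem}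
    (S : St l q C B K 𝒢 a0 V u) {N : ℕ} (hN : {α | opn l q C B V u α}.ncard ≤ N) (hk : K.ncard + N + 2 ≤ k)
    {y : List Bool} (hy : opn l q C B V u y)
    (hG : ∀ e, e <:+ y → e ≠ y → act l q C B V u e → GG l u e ⊆ keySet l (u y)) :
    ∃ V' u', St l q C B K 𝒢 a0 V' u' ∧ V.card < V'.card := by
  classical
  obtain ⟨M0, P0⟩ := S.pre
  have P := pre_shrink E P0
  set O := {α | opn l q C B V u α} with hO
  have hOf : O.Finite := Set.Finite.subset V.finite_toSet (fun α hα => hα.1)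
  have hMc : (K ∪ u '' O).ncard ≤ K.ncard + N :=
    (Set.ncard_union_le _ _).trans (Nat.add_le_add_left ((Set.ncard_image_le hOf).trans hN) _)
  obtain ⟨V1, u1, M1, P1, h1a, h1b, h1c, h1d, h1e⟩ := pre_dir E P (by omega) true hy.1 (S.stab _ _ hy)
  have hf1 : false :: y ∉ V1 := by
    intro h
    rcases Finset.mem_insert.1 (h1b h) with h | h
    · simp at h
    · exact S.stab _ _ hy h
  obtain ⟨V2, u2, M2, P2, h2a, h2b, h2c, h2d, h2e⟩ := pre_dir E P1 (by omega) false (h1a hy.1) hf1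
  have hVV : V ⊆ V2 := h1a.trans h2a
  have huu : ∀ α ∈ V, u2 α = u α := fun α hα => (h2c α (h1a hα)).trans (h1c α hα)
  have hcase : ∀ α ∈ V2, α ∈ V ∨ ∃ b, α = b :: y := by
    intro α hα
    rcases Finset.mem_insert.1 (h2b hα) with h | h
    · exact Or.inr ⟨_, h⟩
    · rcases Finset.mem_insert.1 (h1b h) with h | h
      · exact Or.inr ⟨_, h⟩
      · exact Or.inl h
  have himg12 : img V1 u1 ⊆ img V2 u2 := by
    rintro _ ⟨β, hβ, rfl⟩
    exact ⟨β, h2a hβ, h2c β hβ⟩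
  have hcov : ∀ x ∈ C, cf q (u y) x → cov l (B ∪ img V2 u2) x := by
    intro x hx hc
    obtain ⟨b, hb⟩ := cf_dirn hc
    cases b
    · rw [← h1c y hy.1] at hb; exact h2e x hx hb
    · exact cov_mono (Set.union_subset_union_right _ himg12) (h1e x hx hb)
  have hyn : ¬ opn l q C B V2 u2 y := by
    rintro ⟨-, x, hx, h1, h2⟩
    rw [huu y hy.1] at h1
    exact h2 (hcov x hx h1)
  have hact : ∀ e, ¬ (y <:+ e) → act l q C B V2 u2 e → act l q C B V u e := by
    intro e he h b
    obtain ⟨o, ho, hbo⟩ := h b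
    rcases hcase o ho.1 with h1 | ⟨c, rfl⟩
    · exact ⟨o, opn_mono hVV huu h1 ho, hbo⟩
    · rcases List.suffix_cons_iff.1 hbo with h2 | h2
      · exact absurd (by rw [(List.cons.inj h2).2]) he
      · exact ⟨y, hy, h2⟩
  refine ⟨V2, u2, ⟨⟨M2, P2⟩, ?_, ?_⟩, ?_⟩
  · intro b α hα hb
    rcases hcase _ hb with h | ⟨c, h⟩
    · rcases hcase _ hα.1 with h' | ⟨c, rfl⟩
      · exact S.stab b α (opn_mono hVV huu h' hα) h
      · exact S.stab _ _ hy (P.suf _ _ h)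
    · rw [(List.cons.inj h).2] at hα; exact hyn hα
  · intro o ho e heo hne hae
    rcases hcase o ho.1 with h | ⟨c, rfl⟩
    · have hye : ¬ (y <:+ e) := by
        intro hye
        obtain ⟨s, hs⟩ := hye.trans heo
        rcases List.eq_nil_or_concat s with rfl | ⟨s', c, rfl⟩
        · simp only [List.nil_append] at hs
          subst hs
          exact hyn ho
        · have : c :: y <:+ o := ⟨s', by rw [← hs]; simp⟩
          exact S.stab _ _ hy (suf_mem P.suf this h)
      have hae' := hact e hye hae
      have hgg : GG l u2 e = GG l u e := by
        unfold GG
        rw [huu _ (act_mem P.suf hae' true), huu _ (act_mem P.suf hae' false), huu _ (P.suf _ _ (act_mem P.suf hae' true))]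
      rw [hgg, huu]
      · exact S.J o (opn_mono hVV huu h ho) e heo hne hae'
      · cases o with
        | nil => exact h
        | cons a o => exact P.suf _ _ h
    · rcases List.suffix_cons_iff.1 heo with h2 | h2
      · exact absurd h2 hne
      · simp only [List.tail_cons]
        by_cases hey : e = y
        · subst hey; exact gSet_sub _ _ _
        · have hye : ¬ (y <:+ e) := fun h => hey (List.IsSuffix.eq_of_length_le h2 h.length_le)
          have hae' := hact e hye hae
          have hgg : GG l u2 e = GG l u e := by
            unfold GG
            rw [huu _ (act_mem P.suf hae' true), huu _ (act_mem P.suf hae' false), huu _ (P.suf _ _ (act_mem P.suf hae' true))]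
          rw [hgg, huu y hy.1]
          exact hG e h2 hey hae'
  · apply Finset.card_lt_card
    rw [Finset.ssubset_iff_subset_ne]
    refine ⟨hVV, fun hEq => ?_⟩
    subst hEq
    obtain ⟨-, x, hx, h1, h2⟩ := hy
    apply h2
    refine cov_mono ?_ (hcov x hx h1)
    apply Set.union_subset_union_right
    rintro _ ⟨β, hβ, rfl⟩
    exact ⟨β, hβ, (huu β hβ).symm⟩

theorem st_init (E : Env l q k C B K 𝒢 a0) (hKG : K ∈ 𝒢) (hKk : K.ncard < k)
    {z : Fin n → Elem} (hz : z ∈ C) (hcf : cf q a0 z) (hu : ¬ cov l B z) :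
    ∃ u, St l q C B K 𝒢 a0 {[]} u := by
  obtain ⟨u, M, P⟩ := pre_init E hKG hKk hz hcf hu
  refine ⟨u, ⟨M, P⟩, by simp, ?_⟩
  intro o ho e heo hne
  have : o = [] := by simpa using ho.1
  subst this
  exact absurd (List.suffix_nil.1 heo) hne

end
end CQAP

namespace CQAP
open CQA
variable {n l : ℕ} {Elem Var : Type}

section
variable {q : Query n Var} {k : ℕ} {C B K : Set (Fin n → Elem)}
    {𝒢 : Set (Set (Fin n → Elem))} {a0 : Fin n → Elem}

def sideN (v s : List Bool) (b : Bool) (j : ℕ) : List Bool := s.drop (s.length - j) ++ b :: v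

theorem sideN_len (v s : List Bool) (b : Bool) (j : ℕ) (hj : j ≤ s.length) :
    (sideN v s b j).length = v.length + 1 + j := by
  unfold sideN; simp; omega

theorem sideN_suf (v s : List Bool) (b : Bool) (j : ℕ) : sideN v s b j <:+ s ++ b :: v := by
  refine ⟨s.take (s.length - j), ?_⟩
  unfold sideN
  rw [← List.append_assoc, List.take_append_drop]

theorem sideN_succ (v s : List Bool) (b : Bool) (j : ℕ) (hj : j < s.length) :
    ∃ c, sideN v s b (j+1) = c :: sideN v s b j := by
  unfold sideN
  rw [List.drop_eq_getElem_cons (by omega)]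
  have : s.length - (j+1) + 1 = s.length - j := by omega
  rw [this]
  exact ⟨_, rfl⟩

theorem trap (E : Env l q k C B K 𝒢 a0) {V : Finset (List Bool)} {u : List Bool → Fin n → Elem}
    {M : Set (Fin n → Elem)} (P : Pre l q C B K 𝒢 a0 V u M) {v w1 w2 : List Bool}
    (hw1 : w1 ∈ V) (hw2 : w2 ∈ V) (hs1 : true :: v <:+ w1) (hs2 : false :: v <:+ w2)
    (hg1 : ¬ GG l u v ⊆ keySet l (u w1)) (hg2 : ¬ GG l u v ⊆ keySet l (u w2)) : False := by
  classical
  have hex : ∀ α, ∃ t, α ∈ V → t ∈ C ∧ keyEq l t (u α) ∧ t ≠ u α ∧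
      (∀ b β, α = b :: β → dirn q b t (u β)) ∧ (α = [] → cf q a0 t) := by
    intro α
    by_cases hα : α ∈ V
    · cases α with
      | nil =>
        obtain ⟨t, h1, h2, h3⟩ := P.t0
        refine ⟨t, fun _ => ⟨h1, h2, ?_, by simp, fun _ => h3⟩⟩
        rintro rfl
        exact P.ns (sat_cf (Or.inl (E.KB E.a0K)) (Or.inr ⟨[], P.nil, rfl⟩) h3)
      | cons b β =>
        obtain ⟨t, h1, h2, h3⟩ := P.tt b β hα
        refine ⟨t, fun _ => ⟨h1, h2, ?_, ?_, by simp⟩⟩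
        · rintro rfl
          exact P.ns (sat_cf (Or.inr ⟨β, P.suf _ _ hα, rfl⟩) (Or.inr ⟨_, hα, rfl⟩) (dirn_cf h3))
        · rintro b' β' h
          obtain ⟨rfl, rfl⟩ := List.cons.inj h
          exact h3
    · exact ⟨u α, fun h => absurd h hα⟩
  choose t ht using hex
  obtain ⟨s1, rfl⟩ := hs1
  obtain ⟨s2, rfl⟩ := hs2
  have htv : true :: v ∈ V := suf_mem P.suf ⟨s1, rfl⟩ hw1
  have hfv : false :: v ∈ V := suf_mem P.suf ⟨s2, rfl⟩ hw2
  have hv : v ∈ V := P.suf _ _ htv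
  have ha0B : a0 ∈ B := E.KB E.a0K
  -- side arm facts
  have side : ∀ b s, s ++ b :: v ∈ V →
      (∀ j, sideN v s b j ∈ V) ∧ (∀ j, j < s.length → cf q (u (sideN v s b j)) (t (sideN v s b (j+1)))) := by
    intro b s hw
    have h1 : ∀ j, sideN v s b j ∈ V := fun j => suf_mem P.suf (sideN_suf v s b j) hw
    refine ⟨h1, fun j hj => ?_⟩
    obtain ⟨c, hc⟩ := sideN_succ v s b j hj
    exact dirn_cf ((ht _ (h1 (j+1))).2.2.2.1 _ _ hc)
  have hN : ∀ j, v.drop j ∈ V := fun j => suf_mem P.suf (List.drop_suffix j v) hv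
  let m : Fin 3 → ℕ := ![v.length + 1, s1.length, s2.length]
  let Y : Fin 3 → ℕ → Fin n → Elem := ![fun j => if j ≤ v.length then u (v.drop j) else a0,
    fun j => t (sideN v s1 true j), fun j => t (sideN v s2 false j)]
  let X : Fin 3 → ℕ → Fin n → Elem := ![fun j => t (v.drop j),
    fun j => u (sideN v s1 true j), fun j => u (sideN v s2 false j)]
  let Q : Fin 3 → ℕ → List Bool := ![fun j => v.drop j, fun j => sideN v s1 true j, fun j => sideN v s2 false j]
  have hQV : ∀ α j, Q α j ∈ V := by
    intro α j; fin_cases α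
    · exact hN j
    · exact (side _ _ hw1).1 j
    · exact (side _ _ hw2).1 j
  have hYQ : ∀ α j, j ≤ m α → (α = 0 ∧ j = v.length + 1 ∧ Y α j = a0) ∨ ((α = 0 → j ≤ v.length) ∧ keyEq l (Y α j) (u (Q α j))) := by
    intro α j hj; fin_cases α
    · by_cases h : j ≤ v.length
      · right; refine ⟨fun _ => h, ?_⟩
        show keyEq l (if j ≤ v.length then u (v.drop j) else a0) (u (v.drop j))
        rw [if_pos h]; exact keyEq_refl _
      · left
        have hj' : j ≤ v.length + 1 := hj
        refine ⟨rfl, by omega, ?_⟩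
        show (if j ≤ v.length then u (v.drop j) else a0) = a0
        rw [if_neg h]
    · right; exact ⟨fun h => absurd h (by simp), (ht _ ((side _ _ hw1).1 j)).2.1⟩
    · right; exact ⟨fun h => absurd h (by simp), (ht _ ((side _ _ hw2).1 j)).2.1⟩
  have hQlen : ∀ α j, j ≤ m α → (Q α j).length = if α = 0 then v.length - j else v.length + 1 + j := by
    intro α j hj; fin_cases α
    · show (v.drop j).length = v.length - j
      simp
    · exact sideN_len v s1 true j hj
    · exact sideN_len v s2 false j hj
  have hQ12 : ∀ j i, Q 1 j ≠ Q 2 i := by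
    intro j i h
    have h' : sideN v s1 true j = sideN v s2 false i := h
    unfold sideN at h'
    have := (List.append_inj' h' (by simp)).2
    simp at this
  have hQinj : ∀ α j β i, j ≤ m α → i ≤ m β → (α = 0 → j ≤ v.length) → (β = 0 → i ≤ v.length) →
      Q α j = Q β i → α = β ∧ j = i := by
    intro α j β i hj hi h0 h0' h
    have hl := congrArg List.length h
    rw [hQlen α j hj, hQlen β i hi] at hl
    by_cases hα : α = 0
    · by_cases hβ : β = 0
      · simp only [hα, hβ, if_true] at hl
        exact ⟨hα.trans hβ.symm, by have := h0 hα; have := h0' hβ; omega⟩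
      · simp only [hα, hβ, if_true, if_false] at hl; omega
    · by_cases hβ : β = 0
      · simp only [hα, hβ, if_true, if_false] at hl; omega
      · simp only [hα, hβ, if_false] at hl
        refine ⟨?_, by omega⟩
        fin_cases α <;> fin_cases β
        · rfl
        · exact absurd rfl hα
        · exact absurd rfl hα
        · exact absurd rfl hβ
        · rfl
        · exact absurd h (hQ12 _ _)
        · exact absurd rfl hβ
        · exact absurd h.symm (hQ12 _ _)
        · rfl
  have hesc : ¬ GG l u v ⊆ keySet l a0 := by
    intro h
    have key : ∀ α ∈ V, ¬ keySet l (u α) ⊆ keySet l a0 := fun α hα h => P.unc α hα (E.esc _ (P.uC α hα) h)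
    rcases gSet_cases (l := l) (u (true :: v)) (u v) (u (false :: v)) with h' | h' | h' <;>
      (unfold GG at h; rw [h'] at h)
    · exact key _ htv h
    · exact key _ hv h
    · exact key _ hfv h
  have hY0 : Y 0 0 = u v := by
    show (if 0 ≤ v.length then u (v.drop 0) else a0) = u v
    simp
  have hs0 : ∀ s b, sideN v s b 0 = b :: v := by intro s b; unfold sideN; simp
  have hY1 : Y 1 0 = t (true :: v) := by show t (sideN v s1 true 0) = _; rw [hs0]
  have hY2 : Y 2 0 = t (false :: v) := by show t (sideN v s2 false 0) = _; rw [hs0]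
  have hgg : gSet l (Y 1 0) (Y 0 0) (Y 2 0) = GG l u v := by
    rw [hY0, hY1, hY2]; exact gSet_congr (ht _ htv).2.1 (ht _ hfv).2.1
  have hend : ∀ s b, sideN v s b s.length = s ++ b :: v := by intro s b; unfold sideN; simp
  have hsub : thetaSet m X Y ⊆ C := by
    refine thetaSet_sub ?_ ?_
    · intro α j hj; fin_cases α
      · exact (ht _ (hN j)).1
      · exact P.uC _ ((side _ _ hw1).1 j)
      · exact P.uC _ ((side _ _ hw2).1 j)
    · intro α j hj; fin_cases α
      · show (if j ≤ v.length then u (v.drop j) else a0) ∈ C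
        split_ifs
        · exact P.uC _ (hN j)
        · exact E.BC ha0B
      · exact (ht _ ((side _ _ hw1).1 j)).1
      · exact (ht _ ((side _ _ hw2).1 j)).1
  refine (mkTripath (l := l) (q := q) m X Y ?_ ?_ ?_ ?_ ?_ ?_ ?_).elim (fun T _ => E.ntp _ hsub T)
  · intro α j hj; fin_cases α
    · show keyEq l (t (v.drop j)) (if j ≤ v.length then u (v.drop j) else a0)
      rw [if_pos (Nat.lt_succ_iff.1 hj)]; exact (ht _ (hN j)).2.1
    · exact keyEq_symm (ht _ ((side _ _ hw1).1 j)).2.1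
    · exact keyEq_symm (ht _ ((side _ _ hw2).1 j)).2.1
  · intro α j hj; fin_cases α
    · show (t (v.drop j)) ≠ (if j ≤ v.length then u (v.drop j) else a0)
      rw [if_pos (Nat.lt_succ_iff.1 hj)]; exact (ht _ (hN j)).2.2.1
    · exact ((ht _ ((side _ _ hw1).1 j)).2.2.1).symm
    · exact ((ht _ ((side _ _ hw2).1 j)).2.2.1).symm
  · intro α j hj; fin_cases α
    · show cf q (t (v.drop j)) (if j + 1 ≤ v.length then u (v.drop (j+1)) else a0)
      have hj' : j < v.length + 1 := hj
      split_ifs with h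
      · exact cf_symm (dirn_cf ((ht _ (hN j)).2.2.2.1 _ _ (List.drop_eq_getElem_cons (by omega))))
      · have : j = v.length := by omega
        exact cf_symm ((ht _ (hN j)).2.2.2.2 (by rw [this]; simp))
    · exact (side _ _ hw1).2 j hj
    · exact (side _ _ hw2).2 j hj
  · intro α j β i hj hi h
    have hunc : ∀ α, α ∈ V → ¬ keyEq l a0 (u α) := fun α hα h => P.unc α hα ⟨a0, ha0B, keyEq_symm h⟩
    rcases hYQ α j hj with ⟨h1, h2, h3⟩ | ⟨h1, h2⟩ <;> rcases hYQ β i hi with ⟨h1', h2', h3'⟩ | ⟨h1', h2'⟩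
    · exact ⟨h1.trans h1'.symm, h2.trans h2'.symm⟩
    · rw [h3] at h; exact absurd (keyEq_trans h h2') (hunc _ (hQV _ _))
    · rw [h3'] at h; exact absurd (keyEq_trans (keyEq_symm h) h2) (hunc _ (hQV _ _))
    · exact hQinj α j β i hj hi h1 h1' (P.inj _ (hQV _ _) _ (hQV _ _)
        (keyEq_trans (keyEq_symm h2) (keyEq_trans h h2')))
  · rw [hY0, hY1]; exact (ht _ htv).2.2.2.1 true v rfl
  · rw [hY0, hY2]; exact (ht _ hfv).2.2.2.1 false v rfl
  · intro α; rw [hgg]; fin_cases α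
    · show ¬ GG l u v ⊆ keySet l (if v.length + 1 ≤ v.length then u (v.drop (v.length+1)) else a0)
      rw [if_neg (by omega)]; exact hesc
    · show ¬ GG l u v ⊆ keySet l (t (sideN v s1 true s1.length))
      rw [hend, keySet_congr (ht _ hw1).2.1]; exact hg1
    · show ¬ GG l u v ⊆ keySet l (t (sideN v s2 false s2.length))
      rw [hend, keySet_congr (ht _ hw2).2.1]; exact hg2

theorem suf_cases {v w : List Bool} (h : v <:+ w) : w = v ∨ ∃ b : Bool, b :: v <:+ w := by
  obtain ⟨s, hs⟩ := h
  rcases List.eq_nil_or_concat s with rfl | ⟨s', c, rfl⟩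
  · left; simpa using hs.symm
  · right; exact ⟨c, s', by rw [← hs]; simp⟩

theorem walk (E : Env l q k C B K 𝒢 a0) {V : Finset (List Bool)} {u : List Bool → Fin n → Elem}
    (S : St l q C B K 𝒢 a0 V u) (hO : ∃ o, opn l q C B V u o) :
    ∃ y, opn l q C B V u y ∧ ∀ e, e <:+ y → e ≠ y → act l q C B V u e → GG l u e ⊆ keySet l (u y) := by
  classical
  obtain ⟨M, P⟩ := S.pre
  obtain ⟨L, hL⟩ : ∃ L, ∀ w ∈ V, w.length ≤ L := ⟨V.sup List.length, fun w hw => Finset.le_sup (f := List.length) hw⟩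
  suffices H : ∀ d, ∀ v : List Bool, L + 1 ≤ v.length + d → (∃ o, opn l q C B V u o ∧ v <:+ o) →
      (∀ e, e <:+ v → e ≠ v → act l q C B V u e → ∀ w ∈ V, v <:+ w → GG l u e ⊆ keySet l (u w)) →
      ∃ y, opn l q C B V u y ∧ ∀ e, e <:+ y → e ≠ y → act l q C B V u e → GG l u e ⊆ keySet l (u y) by
    obtain ⟨o, ho⟩ := hO
    refine H (L+1) [] (by simp) ⟨o, ho, List.nil_suffix⟩ ?_
    intro e he hne
    exact absurd (List.suffix_nil.1 he) hne
  intro d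
  induction d with
  | zero =>
    rintro v hv ⟨o, ho, h⟩ -
    have := hL o ho.1
    have := h.length_le
    omega
  | succ d ih =>
    rintro v hv ⟨o, ho, h⟩ hinv
    by_cases hvO : opn l q C B V u v
    · exact ⟨v, hvO, fun e h1 h2 h3 => hinv e h1 h2 h3 v hvO.1 List.suffix_rfl⟩
    have next : ∀ b, (∃ o, opn l q C B V u o ∧ b :: v <:+ o) →
        (act l q C B V u v → ∀ w ∈ V, b :: v <:+ w → GG l u v ⊆ keySet l (u w)) →
        ∃ y, opn l q C B V u y ∧ ∀ e, e <:+ y → e ≠ y → act l q C B V u e → GG l u e ⊆ keySet l (u y) := by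
      intro b h1 h2
      refine ih (b :: v) (by simp; omega) h1 ?_
      intro e he hne hae w hw hbw
      rcases List.suffix_cons_iff.1 he with h3 | h3
      · exact absurd h3 hne
      · by_cases hev : e = v
        · subst hev; exact h2 hae w hw hbw
        · exact hinv e h3 hev hae w hw ((List.suffix_cons b v).trans hbw)
    by_cases hav : act l q C B V u v
    · by_cases h1 : ∀ w ∈ V, true :: v <:+ w → GG l u v ⊆ keySet l (u w)
      · exact next true (hav true) (fun _ => h1)
      · by_cases h2 : ∀ w ∈ V, false :: v <:+ w → GG l u v ⊆ keySet l (u w)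
        · exact next false (hav false) (fun _ => h2)
        · exfalso
          push Not at h1 h2
          obtain ⟨w1, a1, a2, a3⟩ := h1
          obtain ⟨w2, b1, b2, b3⟩ := h2
          exact trap E P a1 b1 a2 b2 a3 b3
    · rcases suf_cases h with rfl | ⟨b, hb⟩
      · exact absurd ho hvO
      · exact next b ⟨o, ho, hb⟩ (fun h => absurd h hav)

open Classical in
theorem depth_bound {V : Finset (List Bool)} {u : List Bool → Fin n → Elem}
    (S : St l q C B K 𝒢 a0 V u) {o : List Bool} (ho : opn l q C B V u o) :
    (V.filter (fun e => e <:+ o ∧ e ≠ o ∧ act l q C B V u e)).card ≤ 2 * l ^ l := by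
  obtain ⟨M, P⟩ := S.pre
  set A := V.filter (fun e => e <:+ o ∧ e ≠ o ∧ act l q C B V u e) with hA
  set W := V.filter (fun w => keySet l (u w) ⊆ keySet l (u o.tail)) with hW
  have hWc : W.card ≤ l ^ l := by
    apply key_count W u (u o.tail)
    · intro s hs; exact (Finset.mem_filter.1 hs).2
    · intro s hs t ht; exact P.inj s (Finset.mem_filter.1 hs).1 t (Finset.mem_filter.1 ht).1
  have hp : ∀ e ∈ A, ∃ w ∈ W, w = e ∨ w.tail = e := by
    intro e he
    obtain ⟨h1, h2, h3, h4⟩ := Finset.mem_filter.1 he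
    have hJ := S.J o ho e h2 h3 h4
    have ht := act_mem P.suf h4 true
    have hf := act_mem P.suf h4 false
    rcases gSet_cases (l := l) (u (true :: e)) (u e) (u (false :: e)) with h' | h' | h' <;>
      (unfold GG at hJ; rw [h'] at hJ)
    · exact ⟨_, Finset.mem_filter.2 ⟨ht, hJ⟩, Or.inr rfl⟩
    · exact ⟨_, Finset.mem_filter.2 ⟨h1, hJ⟩, Or.inl rfl⟩
    · exact ⟨_, Finset.mem_filter.2 ⟨hf, hJ⟩, Or.inr rfl⟩
  have hsub : A ⊆ W ∪ W.image List.tail := by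
    intro e he
    obtain ⟨w, hw, h | h⟩ := hp e he
    · exact Finset.mem_union_left _ (h ▸ hw)
    · exact Finset.mem_union_right _ (Finset.mem_image.2 ⟨w, hw, h⟩)
  have h1 := Finset.card_le_card hsub
  have h2 := Finset.card_union_le W (W.image List.tail)
  have h3 : (W.image List.tail).card ≤ W.card := Finset.card_image_le
  omega

open Classical in
theorem count_open {V : Finset (List Bool)} {u : List Bool → Fin n → Elem}
    (S : St l q C B K 𝒢 a0 V u) : {α | opn l q C B V u α}.ncard ≤ 2 ^ (2 * l ^ l) := by
  obtain ⟨M, P⟩ := S.pre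
  obtain ⟨L, hL⟩ : ∃ L, ∀ w ∈ V, w.length ≤ L := ⟨V.sup List.length, fun w hw => Finset.le_sup (f := List.length) hw⟩
  let O : List Bool → Finset (List Bool) := fun v => V.filter (fun o => opn l q C B V u o ∧ v <:+ o)
  let A : List Bool → Finset (List Bool) := fun v => V.filter (fun e => e <:+ v ∧ e ≠ v ∧ act l q C B V u e)
  suffices H : ∀ d, ∀ v : List Bool, L + 1 ≤ v.length + d → (O v).card * 2 ^ (A v).card ≤ 2 ^ (2 * l ^ l) by
    have h := H (L+1) [] (by simp)
    have hA : (A []).card = 0 := by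
      rw [Finset.card_eq_zero, Finset.filter_eq_empty_iff]
      rintro e - ⟨h1, h2, -⟩
      exact h2 (List.suffix_nil.1 h1)
    rw [hA, pow_zero, mul_one] at h
    refine le_trans (le_of_eq ?_) h
    rw [← Set.ncard_coe_finset]
    congr 1
    ext α
    simp only [Set.mem_ofPred_eq, O, Finset.coe_filter, List.nil_suffix, and_true]
    exact ⟨fun h => ⟨h.1, h⟩, fun h => h.2⟩
  intro d
  induction d with
  | zero =>
    intro v hv
    have : O v = ∅ := by
      rw [Finset.filter_eq_empty_iff]
      rintro o ho ⟨h1, h2⟩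
      have := hL o ho
      have := h2.length_le
      omega
    rw [this]; simp
  | succ d ih =>
    intro v hv
    by_cases hvO : opn l q C B V u v
    · have h1 : O v ⊆ {v} := by
        intro o ho
        obtain ⟨h1, h2, h3⟩ := Finset.mem_filter.1 ho
        rcases suf_cases h3 with rfl | ⟨b, hb⟩
        · simp
        · exact absurd (suf_mem P.suf hb h1) (S.stab _ _ hvO)
      have h2 : (O v).card ≤ 1 := by simpa using Finset.card_le_card h1
      have h3 : (A v).card ≤ 2 * l ^ l := depth_bound S hvO
      calc (O v).card * 2 ^ (A v).card ≤ 1 * 2 ^ (2 * l ^ l) :=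
            Nat.mul_le_mul h2 (Nat.pow_le_pow_right (by norm_num) h3)
        _ = _ := one_mul _
    · have hsub : O v ⊆ O (true :: v) ∪ O (false :: v) := by
        intro o ho
        obtain ⟨h1, h2, h3⟩ := Finset.mem_filter.1 ho
        rcases suf_cases h3 with rfl | ⟨b, hb⟩
        · exact absurd h2 hvO
        · cases b
          · exact Finset.mem_union_right _ (Finset.mem_filter.2 ⟨h1, h2, hb⟩)
          · exact Finset.mem_union_left _ (Finset.mem_filter.2 ⟨h1, h2, hb⟩)
      have hc := (Finset.card_le_card hsub).trans (Finset.card_union_le _ _)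
      have i1 := ih (true :: v) (by simp; omega)
      have i2 := ih (false :: v) (by simp; omega)
      have hAsub : ∀ b, A v ⊆ A (b :: v) := by
        intro b e he
        obtain ⟨h1, h2, h3, h4⟩ := Finset.mem_filter.1 he
        refine Finset.mem_filter.2 ⟨h1, h2.trans (List.suffix_cons b v), ?_, h4⟩
        rintro rfl
        have := h2.length_le
        simp at this
      by_cases hav : act l q C B V u v
      · have hAc : ∀ b, (A v).card + 1 ≤ (A (b :: v)).card := by
          intro b
          have hvA : v ∉ A v := by
            intro h; exact (Finset.mem_filter.1 h).2.2.1 rfl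
          rw [← Finset.card_insert_of_notMem hvA]
          apply Finset.card_le_card
          apply Finset.insert_subset _ (hAsub b)
          exact Finset.mem_filter.2 ⟨P.suf _ _ (act_mem P.suf hav true), List.suffix_cons b v, by simp, hav⟩
        have j : ∀ b, (O (b :: v)).card * 2 ^ ((A v).card + 1) ≤ (O (b :: v)).card * 2 ^ (A (b :: v)).card :=
          fun b => Nat.mul_le_mul_left _ (Nat.pow_le_pow_right (by norm_num) (hAc b))
        have j1 := (j true).trans i1
        have j2 := (j false).trans i2
        have j3 : (O v).card * 2 ^ (A v).card ≤ ((O (true :: v)).card + (O (false :: v)).card) * 2 ^ (A v).card :=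
          Nat.mul_le_mul_right _ hc
        rw [pow_succ] at j1 j2
        rw [add_mul] at j3
        rw [← mul_assoc] at j1 j2
        omega
      · have hz : ∃ b, O (b :: v) = ∅ := by
          by_contra hcon
          push Not at hcon
          apply hav
          intro b
          obtain ⟨o, ho⟩ := hcon b
          obtain ⟨h1, h2, h3⟩ := Finset.mem_filter.1 ho
          exact ⟨o, h2, h3⟩
        have j : ∀ b, (O (b :: v)).card * 2 ^ ((A v).card) ≤ (O (b :: v)).card * 2 ^ (A (b :: v)).card :=
          fun b => Nat.mul_le_mul_left _ (Nat.pow_le_pow_right (by norm_num) (Finset.card_le_card (hAsub b)))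
        have j3 : (O v).card * 2 ^ (A v).card ≤ ((O (true :: v)).card + (O (false :: v)).card) * 2 ^ (A v).card :=
          Nat.mul_le_mul_right _ hc
        rw [add_mul] at j3
        obtain ⟨b, hb⟩ := hz
        have j1 := (j true).trans i1
        have j2 := (j false).trans i2
        cases b
        · rw [hb] at j3; simp only [Finset.card_empty, zero_mul, add_zero] at j3; omega
        · rw [hb] at j3; simp only [Finset.card_empty, zero_mul, zero_add] at j3; omega

end
end CQAP

namespace CQAP
open CQA
variable {n l : ℕ} {Elem Var : Type}

theorem exists_max_set {α : Type} {C : Set α} (hC : C.Finite) (p : Set α → Prop) {S0 : Set α} (h0 : S0 ⊆ C) (hp : p S0) :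
    ∃ S, S ⊆ C ∧ p S ∧ ∀ T, T ⊆ C → p T → S ⊆ T → T = S := by
  have hf : {S | S ⊆ C ∧ p S}.Finite := hC.finite_subsets.subset (fun S hS => hS.1)
  obtain ⟨S, hS⟩ := hf.exists_maximal ⟨S0, h0, hp⟩
  exact ⟨S, hS.prop.1, hS.prop.2, fun T h1 h2 h3 => subset_antisymm (hS.le_of_ge ⟨h1, h2⟩ h3) h3⟩

section
variable {q : Query n Var} {k : ℕ} {C B K : Set (Fin n → Elem)}
    {𝒢 : Set (Set (Fin n → Elem))} {a0 : Fin n → Elem}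

theorem k_bound (l : ℕ) : l ^ l + 2 ^ (2 * l ^ l) + 2 ≤ 2 ^ (2 * l ^ l + 1) + l ^ l - 1 := by
  have h1 : 1 ≤ l ^ l := Nat.one_le_iff_ne_zero.2 (by
    rcases Nat.eq_zero_or_pos l with rfl | h
    · simp
    · positivity)
  have h2 : 2 ^ 2 ≤ 2 ^ (2 * l ^ l) := Nat.pow_le_pow_right (by norm_num) (by omega)
  rw [pow_succ]
  omega

theorem k_bound' (l : ℕ) : l ^ l < 2 ^ (2 * l ^ l + 1) + l ^ l - 1 :=
  lt_of_lt_of_le (by rw [add_assoc]; exact Nat.lt_add_of_pos_right (by positivity)) (k_bound l)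

theorem explore (E : Env l q (2 ^ (2 * l ^ l + 1) + l ^ l - 1) C B K 𝒢 a0) (hKG : K ∈ 𝒢) (hKk : K.ncard ≤ l ^ l)
    {z : Fin n → Elem} (hz : z ∈ C) (hcf : cf q a0 z) (hu : ¬ cov l B z) :
    ∃ B', B ⊆ B' ∧ B' ≠ B ∧ B' ⊆ C ∧ Consistent l B' ∧ ¬ Sat q B' ∧
      ∀ b ∈ B', b ∉ K → ∀ x ∈ C, cf q b x → cov l B' x := by
  classical
  have hkb := k_bound l
  have hfin : ∃ V u, St l q C B K 𝒢 a0 V u ∧ ∀ o, ¬ opn l q C B V u o := by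
    by_contra hcon
    push Not at hcon
    have hN : ∀ N, ∃ V u, St l q C B K 𝒢 a0 V u ∧ N ≤ V.card := by
      intro N
      induction N with
      | zero =>
        obtain ⟨u, hu⟩ := st_init E hKG (lt_of_le_of_lt hKk (k_bound' l)) hz hcf hu
        exact ⟨_, u, hu, Nat.zero_le _⟩
      | succ N ih =>
        obtain ⟨V, u, S, hc⟩ := ih
        obtain ⟨y, hy, hG⟩ := walk E S (hcon V u S)
        obtain ⟨V', u', S', h⟩ := st_step E S (count_open S) (by omega) hy hG
        exact ⟨V', u', S', by omega⟩
    obtain ⟨V, u, S, hc⟩ := hN (C.ncard + 1)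
    obtain ⟨M, P⟩ := S.pre
    have : V.card ≤ C.ncard := by
      rw [Set.ncard_eq_toFinset_card C E.hC]
      apply Finset.card_le_card_of_injOn u
      · intro α hα; simpa using P.uC α hα
      · intro α hα β hβ h
        exact P.inj α hα β hβ (by rw [h]; exact keyEq_refl _)
    omega
  obtain ⟨V, u, S, hno⟩ := hfin
  obtain ⟨M, P⟩ := S.pre
  refine ⟨B ∪ img V u, Set.subset_union_left, ?_, ?_, ?_, P.ns, ?_⟩
  · intro h
    have : u [] ∈ B := by rw [← h]; exact Or.inr ⟨[], P.nil, rfl⟩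
    exact P.unc [] P.nil ⟨_, this, keyEq_refl _⟩
  · apply Set.union_subset E.BC
    rintro _ ⟨α, hα, rfl⟩; exact P.uC α hα
  · rintro a (ha | ⟨α, hα, rfl⟩) b (hb | ⟨β, hβ, rfl⟩) hab
    · exact E.cons a ha b hb hab
    · exact absurd ⟨a, ha, keyEq_symm hab⟩ (P.unc β hβ)
    · exact absurd ⟨b, hb, hab⟩ (P.unc α hα)
    · rw [P.inj α hα β hβ hab]
  · rintro b (hb | ⟨α, hα, rfl⟩) hbK x hx hc
    · exact cov_mono Set.subset_union_left (E.clo b hb hbK x hx hc)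
    · by_contra h
      exact hno α ⟨hα, x, hx, hc, h⟩

theorem partE (hC : C.Finite) (hq : TwoWayDet l q) (g0 : ∅ ∈ 𝒢)
    (g1 : ∀ S ∈ 𝒢, ∀ T ⊆ S, T ∈ 𝒢)
    (g2 : ∀ S ∈ 𝒢, ¬ Sat q S)
    (g3 : ∀ S ∈ 𝒢, S.Finite → S.ncard < 2 ^ (2 * l ^ l + 1) + l ^ l - 1 →
      ∀ x ∈ C, ¬ cov l S x → ∃ u ∈ C, keyEq l x u ∧ insert u S ∈ 𝒢)
    (ntp : ∀ Θ ⊆ C, Tripath l q Θ → False) :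
    ∃ r ⊆ C, Consistent l r ∧ (∀ x ∈ C, cov l r x) ∧ ¬ Sat q r := by
  classical
  have hkb := k_bound l
  obtain ⟨A, hAC, ⟨hA1, hA2, hA3⟩, hAmax⟩ := exists_max_set hC
    (fun A => Consistent l A ∧ ¬ Sat q A ∧ ∀ a ∈ A, ∀ x ∈ C, cf q a x → cov l A x)
    (Set.empty_subset C) ⟨by rintro a ⟨⟩, by rintro ⟨a, b, ⟨⟩, -⟩, by rintro a ⟨⟩⟩
  refine ⟨A, hAC, hA1, ?_, hA2⟩
  by_contra hcon
  push Not at hcon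
  obtain ⟨x, hx, hxA⟩ := hcon
  obtain ⟨K, hKC, ⟨hK1, hK2, hK3⟩, hKmax⟩ := exists_max_set hC
    (fun K => K ∈ 𝒢 ∧ Consistent l K ∧ ∀ a ∈ K, keySet l a ⊆ keySet l x ∧ ¬ cov l A a)
    (Set.empty_subset C) ⟨g0, by rintro a ⟨⟩, by rintro a ⟨⟩⟩
  have hKf : K.Finite := hC.subset hKC
  have hKc : K.ncard ≤ l ^ l := by
    rw [Set.ncard_eq_toFinset_card K hKf]
    apply key_count hKf.toFinset id x
    · intro s hs; exact (hK3 s (by simpa using hs)).1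
    · intro s hs t ht h; exact hK2 s (by simpa using hs) t (by simpa using ht) h
  have hKcov : ∀ y ∈ C, keySet l y ⊆ keySet l x → cov l (A ∪ K) y := by
    intro y hy hyx
    by_contra hno
    obtain ⟨v, hv, hyv, hvG⟩ := g3 K hK1 hKf (lt_of_le_of_lt hKc (k_bound' l)) y hy (fun h => hno (cov_mono Set.subset_union_right h))
    have hvn : ¬ cov l (A ∪ K) v := fun h => hno (cov_congr hyv h)
    have := hKmax (insert v K) (Set.insert_subset hv hKC) ⟨hvG, ?_, ?_⟩ (Set.subset_insert _ _)
    · exact hvn ⟨v, Or.inr (this ▸ Set.mem_insert _ _), keyEq_refl _⟩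
    · rintro a (rfl | ha) b (rfl | hb) hab
      · rfl
      · exact absurd ⟨b, Or.inr hb, hab⟩ hvn
      · exact absurd ⟨a, Or.inr ha, keyEq_symm hab⟩ hvn
      · exact hK2 a ha b hb hab
    · rintro a (rfl | ha)
      · exact ⟨(keySet_congr hyv) ▸ hyx, fun h => hvn (cov_mono Set.subset_union_left h)⟩
      · exact hK3 a ha
  obtain ⟨B, hBC, ⟨hB0, hB1, hB2, hB3⟩, hBmax⟩ := exists_max_set hC
    (fun B => A ∪ K ⊆ B ∧ Consistent l B ∧ ¬ Sat q B ∧ ∀ b ∈ B, b ∉ K → ∀ x ∈ C, cf q b x → cov l B x)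
    (Set.union_subset hAC hKC) ⟨subset_rfl, by
      rintro a (ha | ha) b (hb | hb) hab
      · exact hA1 a ha b hb hab
      · exact absurd ⟨a, ha, keyEq_symm hab⟩ (hK3 b hb).2
      · exact absurd ⟨b, hb, hab⟩ (hK3 a ha).2
      · exact hK2 a ha b hb hab, by
      rintro ⟨a, b, ha | ha, hb | hb, hab⟩
      · exact hA2 ⟨a, b, ha, hb, hab⟩
      · exact (hK3 b hb).2 (hA3 a ha b (hKC hb) (Or.inl hab))
      · exact (hK3 a ha).2 (hA3 b hb a (hKC ha) (Or.inr hab))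
      · exact g2 K hK1 ⟨a, b, ha, hb, hab⟩, by
      rintro b (hb | hb) hbK y hy hc
      · exact cov_mono Set.subset_union_left (hA3 b hb y hy hc)
      · exact absurd hb hbK⟩
  have hAB : A ⊆ B := Set.subset_union_left.trans hB0
  have hKB : K ⊆ B := Set.subset_union_right.trans hB0
  by_cases hcl : ∀ b ∈ B, ∀ y ∈ C, cf q b y → cov l B y
  · have := hAmax B hBC ⟨hB1, hB2, hcl⟩ hAB
    have hxB := cov_mono hB0 (hKcov x hx subset_rfl)
    rw [this] at hxB
    exact hxA hxB
  · push Not at hcl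
    obtain ⟨a0, ha0, z, hz, hc, hzu⟩ := hcl
    have ha0K : a0 ∈ K := by
      by_contra h; exact hzu (hB3 a0 ha0 h z hz hc)
    have E : Env l q (2 ^ (2 * l ^ l + 1) + l ^ l - 1) C B K 𝒢 a0 :=
      { hC := hC, hq := hq, g1 := g1, g2 := g2, g3 := g3, ntp := ntp, BC := hBC, cons := hB1, nsB := hB2, KB := hKB,
        clo := hB3, a0K := ha0K,
        esc := fun y hy h => cov_mono hB0 (hKcov y hy (h.trans (hK3 a0 ha0K).1)) }
    obtain ⟨B', h1, h2, h3, h4, h5, h6⟩ := explore E hK1 hKc hz hc hzu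
    exact h2 (hBmax B' h3 ⟨hB0.trans h1, h4, h5, h6⟩ h1)

end
end CQAP

namespace CQAP
open CQA
variable {n l : ℕ} {Elem Var : Type}

theorem dual_solve {P V : Type} [Fintype P] [DecidableEq P] (A B : P → V) (t : P → ℚ)
    (h : ∀ ω : P → ℚ, (∀ F : V → ℚ, ∑ p, ω p * F (A p) = ∑ p, ω p * F (B p)) → ∑ p, ω p * t p = 0) :
    ∃ F : V → ℚ, ∀ p, F (A p) - F (B p) = t p := by
  let L : (V → ℚ) →ₗ[ℚ] (P → ℚ) :=
    { toFun := fun F p => F (A p) - F (B p)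
      map_add' := by intro F G; ext p; simp; ring
      map_smul' := by intro c F; ext p; simp; ring }
  by_contra hc
  have hn : t ∉ LinearMap.range L := by
    rintro ⟨F, hF⟩
    exact hc ⟨F, fun p => congrFun hF p⟩
  obtain ⟨f, hf1, hf2⟩ := Submodule.exists_le_ker_of_notMem hn
  have hfx : ∀ x : P → ℚ, f x = ∑ p, f (Pi.single p 1) * x p := by
    intro x
    rw [LinearMap.pi_apply_eq_sum_univ f x]
    refine Finset.sum_congr rfl fun p _ => ?_
    rw [smul_eq_mul, mul_comm]
    congr 2
    ext j
    simp [Pi.single_apply, eq_comm]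
  apply hf1
  rw [hfx]
  apply h
  intro F
  have h0 : f (L F) = 0 := hf2 ⟨F, rfl⟩
  rw [hfx] at h0
  have : ∀ p, f (Pi.single p 1) * L F p = f (Pi.single p 1) * F (A p) - f (Pi.single p 1) * F (B p) := by
    intro p; show _ * (F (A p) - F (B p)) = _; ring
  simp only [this, Finset.sum_sub_distrib] at h0
  linarith

abbrev KP (n l : ℕ) := {p : Fin n // p.1 < l}

def Circ (l : ℕ) (q : Query n Var) (ω : KP n l → ℚ) : Prop :=
  ∀ F : Var → ℚ, ∑ p, ω p * F (q.1 p.1) = ∑ p, ω p * F (q.2 p.1)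

open Classical in
noncomputable def Inv (ω : KP n l → ℚ) (y : Elem) (x : Fin n → Elem) : ℚ :=
  ∑ p, ω p * if x p.1 = y then 1 else 0

theorem Inv_sol {q : Query n Var} {ω : KP n l → ℚ} (hω : Circ l q ω) (y : Elem) {a b : Fin n → Elem}
    (h : solPair q a b) : Inv ω y a = Inv ω y b := by
  classical
  obtain ⟨μ, h1, h2⟩ := h
  have := hω (fun v => if μ v = y then 1 else 0)
  simp only [h1, h2] at this
  unfold Inv
  convert this

theorem Inv_key {ω : KP n l → ℚ} (y : Elem) {a b : Fin n → Elem}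
    (h : keyEq l a b) : Inv ω y a = Inv ω y b := by
  unfold Inv
  refine Finset.sum_congr rfl fun p _ => ?_
  rw [h p.1 p.2]

theorem Inv_ne {ω : KP n l → ℚ} {y : Elem} {a : Fin n → Elem} (h : Inv ω y a ≠ 0) : y ∈ keySet l a := by
  by_contra hc
  apply h
  unfold Inv
  refine Finset.sum_eq_zero fun p _ => ?_
  rw [if_neg, mul_zero]
  intro h; exact hc ⟨p.1, p.2, h⟩

theorem Inv_conn {q : Query n Var} {D : Set (Fin n → Elem)} {ω : KP n l → ℚ} (hω : Circ l q ω) (y : Elem)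
    {a b : Fin n → Elem} (h : qConn l q D a b) : Inv ω y a = Inv ω y b := by
  induction h with
  | rel a b h =>
    rcases h with h | ⟨a', b', ha, hb, h⟩
    · exact Inv_key y h
    · rw [Inv_key y ha.2, Inv_key y hb.2]
      rcases h with h | h
      · exact Inv_sol hω y h.2.2
      · exact (Inv_sol hω y h.2.2).symm
  | refl => rfl
  | symm _ _ _ ih => exact ih.symm
  | trans _ _ _ _ _ ih1 ih2 => exact ih1.trans ih2

def Lost (l : ℕ) (q : Query n Var) (c : ZMod 3 → Fin n → Elem) (y : Elem) : Prop :=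
  ∀ ω : KP n l → ℚ, Circ l q ω → ∀ i, Inv ω y (c i) = 0

theorem potential (q : Query n Var) (c : ZMod 3 → Fin n → Elem) (r : ZMod 3 → Var → Elem)
    (hA : ∀ i p, r i (q.1 p) = c i p) (hB : ∀ i p, r i (q.2 p) = c (i+1) p) :
    ∃ (tg : Var → Prop) (θ : Var → ℚ), ∀ p : KP n l,
      (tg (q.1 p.1) ↔ tg (q.2 p.1)) ∧ (tg (q.1 p.1) → θ (q.1 p.1) = θ (q.2 p.1) + 1) ∧
      ∀ i, Lost l q c (c i p.1) → tg (q.1 p.1) := by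
  classical
  have hF : ∀ y, ∃ F : ZMod 3 → Var → ℚ, Lost l q c y → ∀ i, ∀ p : KP n l,
      F i (q.1 p.1) - F i (q.2 p.1) = if c i p.1 = y then 1 else 0 := by
    intro y
    by_cases hy : Lost l q c y
    · have : ∀ i, ∃ F : Var → ℚ, ∀ p : KP n l,
        F (q.1 p.1) - F (q.2 p.1) = if c i p.1 = y then 1 else 0 := by
        intro i
        refine dual_solve (fun p : KP n l => q.1 p.1) (fun p => q.2 p.1) _ ?_
        intro ω hω
        have := hy ω hω i
        unfold Inv at this
        convert this
      choose F hF using this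
      exact ⟨F, fun _ => hF⟩
    · exact ⟨fun _ _ => 0, fun h => absurd h hy⟩
  choose F hF using hF
  let S : Var → Set Elem := fun v => {y | Lost l q c y ∧ ∃ i, r i v = y}
  have hS : ∀ p : KP n l, S (q.1 p.1) = S (q.2 p.1) := by
    intro p
    ext y
    simp only [S, Set.mem_ofPred_eq, hA, hB]
    constructor
    · rintro ⟨h, i, hi⟩; exact ⟨h, i - 1, by simpa using hi⟩
    · rintro ⟨h, i, hi⟩; exact ⟨h, i + 1, by simpa using hi⟩
  let N : Elem → Var → ℚ := fun y v => ∑ i : ZMod 3, if r i v = y then 1 else 0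
  let G : Set Elem → Var → ℚ := fun s v =>
    if h : s.Nonempty then (∑ i, F h.choose i v) / N h.choose v else 0
  refine ⟨fun v => (S v).Nonempty, fun v => G (S v) v, fun p => ⟨by simp only [hS p], ?_, ?_⟩⟩
  · intro h
    have h' := h
    rw [hS p] at h'
    beta_reduce
    rw [hS p]
    simp only [G, dif_pos h']
    obtain ⟨hL, i0, hi0⟩ := h'.choose_spec
    set y := h'.choose
    have hN : N y (q.1 p.1) = N y (q.2 p.1) := by
      simp only [N, hA, hB]
      exact (Equiv.sum_comp (Equiv.addRight (1 : ZMod 3)) (fun i => if c i p.1 = y then (1:ℚ) else 0)).symm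
    have hpos : 0 < N y (q.2 p.1) := by
      refine Finset.sum_pos' (fun i _ => ?_) ⟨i0, Finset.mem_univ _, ?_⟩
      · split_ifs <;> norm_num
      · rw [if_pos hi0]; norm_num
    have hsum : ∑ i, F y i (q.1 p.1) - ∑ i, F y i (q.2 p.1) = N y (q.1 p.1) := by
      rw [← Finset.sum_sub_distrib]
      simp only [N, hA]
      exact Finset.sum_congr rfl fun i _ => hF y hL i p
    rw [hN] at hsum ⊢
    field_simp
    linarith
  · intro i hi
    exact ⟨c i p.1, hi, i, hA i p.1⟩

end CQAP

namespace CQAP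
open CQA
variable {n l : ℕ} {Elem Var : Type}

def ht (β : ℕ → Bool) : ℕ → ℤ
  | 0 => 0
  | j+1 => ht β j + if β j then 1 else -1

def GoodStart (l : ℕ) (q : Query n Var) (w : Fin n → Elem) : Prop :=
  ∃ (X Y : ℕ → Fin n → Elem) (β : ℕ → Bool), keyEq l w (X 0) ∧ (∀ j, keyEq l (X (j+1)) (Y (j+1))) ∧
    (∀ j, if β j then solPair q (X j) (Y (j+1)) else solPair q (Y (j+1)) (X j)) ∧
    ∀ N : ℤ, ∃ m, N < ht β m

theorem GoodStart.congr {q : Query n Var} {w w' : Fin n → Elem} (h : keyEq l w' w) (hw : GoodStart l q w) :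
    GoodStart l q w' := by
  obtain ⟨X, Y, β, h0, h1⟩ := hw
  exact ⟨X, Y, β, keyEq_trans h h0, h1⟩

theorem ht_cons (b : Bool) (β : ℕ → Bool) (m : ℕ) :
    ht (fun j => Nat.casesOn j b β) (m+1) = (if b then 1 else -1) + ht β m := by
  induction m with
  | zero => simp [ht]
  | succ m ih => rw [ht, ih, ht]; simp only [add_assoc]

theorem GoodStart.step {q : Query n Var} {a b : Fin n → Elem} (h : cf q a b) (hw : GoodStart l q b) :
    GoodStart l q a := by
  classical
  obtain ⟨X, Y, β, h0, h1, h2, h3⟩ := hw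
  refine ⟨fun j => Nat.casesOn j a X, fun j => Nat.casesOn j a (fun j => Nat.casesOn j b (fun j => Y (j+1))),
    fun j => Nat.casesOn j (decide (solPair q a b)) β, keyEq_refl _, ?_, ?_, ?_⟩
  · rintro (_ | j)
    · exact keyEq_symm h0
    · exact h1 j
  · rintro (_ | j)
    · by_cases hs : solPair q a b
      · simp [hs]
      · simpa [hs] using h.resolve_left hs
    · exact h2 j
  · intro N
    obtain ⟨m, hm⟩ := h3 (N+1)
    refine ⟨m+1, ?_⟩
    rw [ht_cons]
    split_ifs <;> omega

theorem GoodStart.conn {q : Query n Var} {D : Set (Fin n → Elem)}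
    {a b : Fin n → Elem} (h : qConn l q D a b) : GoodStart l q a ↔ GoodStart l q b := by
  induction h with
  | rel a b h =>
    rcases h with h | ⟨a', b', ha, hb, h⟩
    · exact ⟨GoodStart.congr (keyEq_symm h), GoodStart.congr h⟩
    · have h' : cf q a' b' := h.imp (fun h => h.2.2) (fun h => h.2.2)
      constructor
      · intro g
        exact ((g.congr (keyEq_symm ha.2)).step (cf_symm h')).congr hb.2
      · intro g
        exact ((g.congr (keyEq_symm hb.2)).step h').congr ha.2
  | refl => rfl
  | symm _ _ _ ih => exact ih.symm
  | trans _ _ _ _ _ ih1 ih2 => exact ih1.trans ih2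

theorem GoodStart.tri {q : Query n Var} {c : ZMod 3 → Fin n → Elem} (h : ∀ i, solPair q (c i) (c (i+1)))
    (i : ZMod 3) : GoodStart l q (c i) := by
  refine ⟨fun j => c (i + j), fun j => c (i + j), fun _ => true, by simpa using keyEq_refl _,
    fun j => keyEq_refl _, ?_, ?_⟩
  · intro j
    simpa [add_assoc] using h (i+j)
  · intro N
    have : ∀ m, ht (fun _ => true) m = m := by
      intro m; induction m with
      | zero => rfl
      | succ m ih => rw [ht, ih]; simp
    refine ⟨(N+1).toNat, ?_⟩
    rw [this]; omega

open Classical in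
noncomputable def Ef (i : ℕ → ℤ) (a b : ℚ) : ℕ → ℚ → ℕ
  | 0, _ => 0
  | j+1, x => if a ≤ x + i j ∧ x + i j ≤ b then Ef i a b j x else j+1

theorem Ef_le (i : ℕ → ℤ) (a b : ℚ) (j : ℕ) (x : ℚ) : Ef i a b j x ≤ j := by
  induction j with
  | zero => rfl
  | succ j ih => rw [Ef]; split_ifs <;> omega

theorem Ef_ne (i : ℕ → ℤ) (a b : ℚ) (j : ℕ) (x : ℚ) (h : x + i 0 < a) : Ef i a b (j+1) x ≠ 0 := by
  induction j with
  | zero => rw [Ef, if_neg]; omega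
            intro h'; linarith [h'.1]
  | succ j ih => rw [Ef]; split_ifs; exact ih; omega

abbrev ZZ (Elem : Type) := (Elem × Elem) × Option (Fin 3 × ℚ × ℕ)

open Classical in
noncomputable def tagO (α : Fin 3) (t : Prop) (x : ℚ) (k : ℕ) : Option (Fin 3 × ℚ × ℕ) :=
  if t ∧ k ≠ 0 then some (α, x, k) else none

theorem arm {q : Query n Var} (hq : TwoWayDet l q) (c : ZMod 3 → Fin n → Elem) (r : ZMod 3 → Var → Elem)
    (hA : ∀ i p, r i (q.1 p) = c i p) (hB : ∀ i p, r i (q.2 p) = c (i+1) p)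
    (tg : Var → Prop) (θ : Var → ℚ) (Ls : Elem → Prop)
    (hp1 : ∀ p : KP n l, tg (q.1 p.1) ↔ tg (q.2 p.1))
    (hp2 : ∀ p : KP n l, tg (q.1 p.1) → θ (q.1 p.1) = θ (q.2 p.1) + 1)
    (hp3 : ∀ p : KP n l, ∀ i, Ls (c i p.1) → tg (q.1 p.1))
    (hex : ∃ p : KP n l, tg (q.1 p.1)) (α : Fin 3) (s : ℤ) (w : Fin n → Elem) (hw : GoodStart l q w) :
    ∃ (m : ℕ) (X Y : ℕ → Fin n → ZZ Elem),
      Y 0 = (fun p => ((w p, c s p), none)) ∧ (∀ j, keyEq l (X j) (Y j)) ∧ (∀ j, X j ≠ Y j) ∧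
      (∀ j, cf q (X j) (Y (j+1))) ∧
      (∀ j p β x k, (Y j p).2 = some (β, x, k) → β = α ∧ k ≤ j) ∧
      (∀ j, 1 ≤ j → ∃ p : KP n l, ∃ x, (Y j p.1).2 = some (α, x, j)) ∧
      (∀ p : KP n l, (Y m p.1).2 = none → ¬ Ls (Y m p.1).1.2) := by
  classical
  obtain ⟨X0, Y0, β, g0, g1, g2, g3⟩ := hw
  -- min and max
  let I : Finset (KP n l) := Finset.univ.filter fun p => tg (q.1 p.1)
  have hI : I.Nonempty := by obtain ⟨p, hp⟩ := hex; exact ⟨p, by simp [I, hp]⟩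
  obtain ⟨pa, hpa, hmin⟩ := Finset.exists_min_image I (fun p => θ (q.1 p.1)) hI
  obtain ⟨pb, hpb, hmax⟩ := Finset.exists_max_image I (fun p => θ (q.1 p.1)) hI
  set a := θ (q.1 pa.1) with ha
  set b := θ (q.1 pb.1) with hb
  simp only [I, Finset.mem_filter, Finset.mem_univ, true_and] at hpa hpb hmin hmax
  let i : ℕ → ℤ := fun j => s + ht β j
  have hi0 : i 0 = s := by simp [i, ht]
  have hit : ∀ j, β j = true → i (j+1) = i j + 1 := by intro j h; simp [i, ht, h]; ring
  have hif : ∀ j, β j = false → i (j+1) = i j - 1 := by intro j h; simp [i, ht, h]; ring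
  let low : ℕ → ℤ := fun j => if β j then i j else i (j+1)
  have hμ : ∀ j, ∃ μ : Var → Elem, (∀ p, μ (if β j then q.1 p else q.2 p) = X0 j p) ∧
      (∀ p, μ (if β j then q.2 p else q.1 p) = Y0 (j+1) p) := by
    intro j
    have := g2 j
    cases h : β j
    · rw [h] at this
      obtain ⟨μ, h1, h2⟩ := this
      exact ⟨μ, by simpa using h2, by simpa using h1⟩
    · rw [h] at this
      obtain ⟨μ, h1, h2⟩ := this
      exact ⟨μ, by simpa using h1, by simpa using h2⟩
  choose μ hμ1 hμ2 using hμ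
  let E := Ef i a b
  let ρ : ℕ → Var → ZZ Elem := fun j v =>
    ((μ j v, r (low j) v), tagO α (tg v) (θ v - low j) (E (j+1) (θ v - low j)))
  let X : ℕ → Fin n → ZZ Elem := fun j p => ρ j (if β j then q.1 p else q.2 p)
  let Y : ℕ → Fin n → ZZ Elem := fun j => Nat.casesOn j (fun p => ((w p, c s p), none))
    (fun j p => ρ j (if β j then q.2 p else q.1 p))
  have kX : ∀ j (p : KP n l), X j p.1 = ((X0 j p.1, c (i j) p.1),
      tagO α (tg (q.1 p.1)) (θ (q.1 p.1) - i j) (E (j+1) (θ (q.1 p.1) - i j))) := by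
    intro j p
    have h1 := hμ1 j p.1
    cases h : β j
    · simp only [h, Bool.false_eq_true, if_false] at h1
      have e1 : (low j : ℤ) = i j - 1 := by simp [low, h, hif j h]
      simp only [X, ρ, h, Bool.false_eq_true, if_false, h1, hB, e1, ← hp1 p]
      by_cases ht : tg (q.1 p.1)
      · rw [hp2 p ht]; push_cast; 
        have e2 : θ (q.2 p.1) - (i j - 1 : ℚ) = θ (q.2 p.1) + 1 - i j := by ring
        rw [e2]; simp
      · simp [tagO, ht]
    · simp only [h, if_true] at h1
      have e1 : (low j : ℤ) = i j := by simp [low, h]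
      simp only [X, ρ, h, if_true, h1, hA, e1]
  have kY1 : ∀ j (p : KP n l), Y (j+1) p.1 = ((Y0 (j+1) p.1, c (i (j+1)) p.1),
      tagO α (tg (q.1 p.1)) (θ (q.1 p.1) - i (j+1)) (E (j+1) (θ (q.1 p.1) - i (j+1)))) := by
    intro j p
    have h1 := hμ2 j p.1
    cases h : β j
    · simp only [h, Bool.false_eq_true, if_false] at h1
      have e1 : (low j : ℤ) = i (j+1) := by simp [low, h]
      simp only [Y, ρ, h, Bool.false_eq_true, if_false, h1, hA, e1]
    · simp only [h, if_true] at h1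
      have e1 : (low j : ℤ) = i (j+1) - 1 := by simp [low, h, hit j h]
      simp only [Y, ρ, h, if_true, h1, hB, e1, ← hp1 p]
      by_cases ht : tg (q.1 p.1)
      · rw [hp2 p ht]; push_cast; 
        have e2 : θ (q.2 p.1) - (i (j+1) - 1 : ℚ) = θ (q.2 p.1) + 1 - i (j+1) := by ring
        rw [e2]; simp
      · simp [tagO, ht]
  have hE : ∀ j (p : KP n l), tg (q.1 p.1) → E (j+1) (θ (q.1 p.1) - i j) = E j (θ (q.1 p.1) - i j) := by
    intro j p hp
    simp only [E]
    rw [Ef, if_pos]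
    simp only [sub_add_cancel]
    exact ⟨hmin p hp, hmax p hp⟩
  have hkey : ∀ j, keyEq l (X j) (Y j) := by
    intro j p hp
    rw [kX j ⟨p, hp⟩]
    rcases j with _ | j
    · have g0' := g0 p hp
      simp only [Y, hi0, ← g0']
      congr 1
      by_cases ht : tg (q.1 p)
      · have := hE 0 ⟨p, hp⟩ ht
        rw [hi0] at this
        simp [tagO, this, E, Ef]
      · simp [tagO, ht]
    · rw [kY1 j ⟨p, hp⟩, g1 j p hp]
      congr 1
      by_cases ht : tg (q.1 p)
      · rw [hE (j+1) ⟨p, hp⟩ ht]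
      · simp [tagO, ht]
  have hent : ∀ j p β x k, (Y j p).2 = some (β, x, k) → β = α ∧ k ≤ j := by
    rintro (_ | j) p β x k h
    · simp [Y] at h
    · simp only [Y, ρ, tagO] at h
      split_ifs at h with h' <;>
      · simp only [Option.some.injEq, Prod.mk.injEq] at h
        refine ⟨h.1.symm, ?_⟩
        rw [← h.2.2]; exact Ef_le _ _ _ _ _
  have hnew : ∀ j, ∃ p : KP n l, ∃ x, (Y (j+1) p.1).2 = some (α, x, j+1) := by
    intro j
    cases h : β j
    · refine ⟨pb, θ (q.1 pb.1) - i (j+1), ?_⟩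
      rw [kY1]
      have : E (j+1) (θ (q.1 pb.1) - i (j+1)) = j+1 := by
        simp only [E]; rw [Ef, if_neg]; rw [hif j h]; push_cast; rintro ⟨_, h2⟩; linarith
      simp [tagO, this, hpb]
    · refine ⟨pa, θ (q.1 pa.1) - i (j+1), ?_⟩
      rw [kY1]
      have : E (j+1) (θ (q.1 pa.1) - i (j+1)) = j+1 := by
        simp only [E]; rw [Ef, if_neg]; rw [hit j h]; push_cast; rintro ⟨h2, _⟩; linarith
      simp [tagO, this, hpa]
  obtain ⟨m, hm⟩ := g3 ⌈b - a⌉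
  have hm' : b - a < ht β m := lt_of_le_of_lt (Int.le_ceil _) (by exact_mod_cast hm)
  have hab : a ≤ b := hmin pb hpb
  have hm1 : m ≠ 0 := by rintro rfl; simp [ht] at hm'; linarith
  obtain ⟨m, rfl⟩ := Nat.exists_eq_succ_of_ne_zero hm1
  refine ⟨m+1, X, Y, rfl, hkey, ?_, ?_, hent, ?_, ?_⟩
  · intro j hXY
    obtain ⟨p, x, hp⟩ := hnew j
    have : ∃ p' : Fin n, Y (j+1) p.1 = X j p' := by
      simp only [Y, X]
      cases h : β j
      · obtain ⟨p', hp'⟩ := hq.2.2.1 ⟨p.1, p.2, rfl⟩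
        exact ⟨p', by simp [hp']⟩
      · obtain ⟨p', hp'⟩ := hq.2.2.2 ⟨p.1, p.2, rfl⟩
        exact ⟨p', by simp [hp']⟩
    obtain ⟨p', hp'⟩ := this
    rw [hp', hXY] at hp
    have := (hent _ _ _ _ _ hp).2
    omega
  · intro j
    simp only [X, Y]
    cases h : β j
    · exact Or.inr ⟨ρ j, by simp, by simp⟩
    · exact Or.inl ⟨ρ j, by simp, by simp⟩
  · rintro (_ | j) hj
    · omega
    · exact hnew j
  · intro p hpn hL
    rw [kY1] at hpn hL
    have htg := hp3 p _ hL
    have : E (m+1) (θ (q.1 p.1) - i (m+1)) ≠ 0 := by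
      apply Ef_ne
      have := hmax p htg
      simp only [i, ht, Int.cast_add] at hm' ⊢
      simp only [Int.cast_zero] 
      linarith
    simp [tagO, this, htg] at hpn

end CQAP

namespace CQAP
open CQA
variable {n l : ℕ} {Elem Var : Type}

theorem tri_data {q : Query n Var} {Θ : Set (Fin n → Elem)} (T : Tripath l q Θ) (hT : Sol q Θ T.fc T.dc) :
    ∃ d ∈ Θ, ∃ e ∈ Θ, ∃ f ∈ Θ, ∃ u ∈ Θ, solPair q d e ∧ solPair q e f ∧ solPair q f d ∧
      ¬ keyEq l d e ∧ ¬ keyEq l e f ∧ ¬ keyEq l d f ∧ ¬ gSet l d e f ⊆ keySet l u := by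
  have hblk : ∀ i x, x ∈ T.blk i → T.blk i = Block l Θ x := by
    intro i x hx
    obtain ⟨y, hy, h⟩ := T.blk_is_block i
    rw [h] at hx ⊢
    exact block_congr hx.2
  have hdist : ∀ i j x y, x ∈ T.blk i → y ∈ T.blk j → i ≠ j → ¬ keyEq l x y := by
    intro i j x y hx hy hij hk
    apply hij
    apply T.blk_inj
    rw [hblk i x hx, hblk j y hy]
    exact block_congr hk
  have hself : ∀ i, T.parent i ≠ some i := by
    intro i hi
    have : ∀ j, Relation.ReflTransGen (fun x y => T.parent x = some y) i j → j = i := by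
      intro j hj
      induction hj with
      | refl => rfl
      | tail _ h ih => subst ih; rw [hi] at h; exact (Option.some.inj h).symm
    have h2 := this _ (T.reach_root i)
    rw [← h2, T.parent_root] at hi
    exact absurd hi (by simp)
  have hb : ∀ i, i ≠ T.root → T.bFact i ∈ T.blk i := by
    intro i hi
    by_cases h1 : i = T.leaf1
    · subst h1; rw [T.leaf1_blk]; rfl
    by_cases h2 : i = T.leaf2
    · subst h2; rw [T.leaf2_blk]; rfl
    rw [(T.other_blk i hi h1 h2).2]; right; rfl
  have ha : T.aFact T.branch ∈ T.blk T.branch := by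
    by_cases h0 : T.branch = T.root
    · rw [h0, T.root_blk]; rfl
    have h1 : T.branch ≠ T.leaf1 := fun h => T.leaf1_leaf _ (h ▸ T.parent_child1)
    have h2 : T.branch ≠ T.leaf2 := fun h => T.leaf2_leaf _ (h ▸ T.parent_child1)
    rw [(T.other_blk _ h0 h1 h2).2]; left; rfl
  have hc1 : T.child1 ≠ T.root := by
    intro h; have := T.parent_child1; rw [h, T.parent_root] at this; cases this
  have hc2 : T.child2 ≠ T.root := by
    intro h; have := T.parent_child2; rw [h, T.parent_root] at this; cases this
  have hb1 : T.child1 ≠ T.branch := by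
    intro h; have := T.parent_child1; rw [h] at this; exact hself _ this
  have hb2 : T.child2 ≠ T.branch := by
    intro h; have := T.parent_child2; rw [h] at this; exact hself _ this
  have hu : T.aFact T.root ∈ Θ := by
    have h1 : T.aFact T.root ∈ ⋃ i, T.blk i := by
      refine Set.mem_iUnion.2 ⟨T.root, ?_⟩
      rw [T.root_blk]; rfl
    exact (Set.ext_iff.1 T.blk_cover _).2 h1
  exact ⟨_, T.center_sol1.1, _, T.center_sol1.2.1, _, T.center_sol2.2.1, _, hu,
    T.center_sol1.2.2, T.center_sol2.2.2, hT.2.2, hdist _ _ _ _ (hb _ hc1) ha hb1,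
    hdist _ _ _ _ ha (hb _ hc2) hb2.symm, hdist _ _ _ _ (hb _ hc1) (hb _ hc2) T.child_ne, T.g_root⟩

theorem solPair_map {E' : Type} {q : Query n Var} {a b : Fin n → Elem} (φ : Elem → E') (h : solPair q a b) :
    solPair q (φ ∘ a) (φ ∘ b) := by
  obtain ⟨μ, h1, h2⟩ := h
  exact ⟨φ ∘ μ, fun i => by simp [h1], fun i => by simp [h2]⟩

theorem cf_map {E' : Type} {q : Query n Var} {a b : Fin n → Elem} (φ : Elem → E') (h : cf q a b) :
    cf q (φ ∘ a) (φ ∘ b) := h.imp (solPair_map φ) (solPair_map φ)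

theorem fork_core [Countable Elem] [Infinite Elem] {q : Query n Var} (hq : TwoWayDet l q)
    (hnf : ¬ AdmitsForkTripath l q Elem) (c : ZMod 3 → Fin n → Elem)
    (hc : ∀ i, solPair q (c i) (c (i+1))) (hcd : ∀ i j, keyEq l (c i) (c j) → i = j)
    (hlost : ∀ i, ∃ p : KP n l, Lost l q c (c i p.1))
    {d e f : Fin n → Elem} (hd : GoodStart l q d) (he : GoodStart l q e) (hf : GoodStart l q f)
    (hde : solPair q d e) (hef : solPair q e f) : solPair q f d := by
  classical
  by_contra hfd
  apply hnf
  choose r hA hB using hc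
  obtain ⟨tg, θ, hpot⟩ := potential (l := l) q c r hA hB
  have hex : ∃ p : KP n l, tg (q.1 p.1) := by
    obtain ⟨p, hp⟩ := hlost 0
    exact ⟨p, (hpot p).2.2 0 hp⟩
  let s : Fin 3 → ℤ := ![1, 0, 2]
  let w : Fin 3 → Fin n → Elem := ![e, d, f]
  have hw : ∀ α, GoodStart l q (w α) := by
    intro α; fin_cases α
    · exact he
    · exact hd
    · exact hf
  choose m X Y hY0 hk hne hcf hent hnew hend using fun α => arm hq c r hA hB tg θ (Lost l q c)
    (fun p => (hpot p).1) (fun p => (hpot p).2.1) (fun p => (hpot p).2.2) hex α (s α) (w α) (hw α)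
  obtain ⟨ι⟩ : Nonempty (ZZ Elem ↪ Elem) := by
    obtain ⟨g, hg⟩ := exists_injective_nat (ZZ Elem)
    exact ⟨(Function.Embedding.mk g hg).trans (Infinite.natEmbedding Elem)⟩
  have hs : ∀ α β, ((s α : ℤ) : ZMod 3) = s β → α = β := by
    intro α β; fin_cases α <;> fin_cases β <;> simp [s] <;> decide
  have hkι : ∀ a b : Fin n → ZZ Elem, keyEq l (ι ∘ a) (ι ∘ b) → keyEq l a b :=
    fun a b h p hp => ι.injective (h p hp)
  have hgs : ∀ α, ∃ p : KP n l, ∃ z : ZZ Elem, Y α 0 p.1 = z ∧ z.2 = none ∧ Lost l q c z.1.2 := by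
    intro α
    obtain ⟨p, hp⟩ := hlost (s α)
    refine ⟨p, _, rfl, ?_⟩
    rw [hY0]; exact ⟨rfl, hp⟩
  have hinj : ∀ α j β i, keyEq l (Y α j) (Y β i) → i ≤ j → α = β ∧ j = i := by
    intro α j β i h hij
    rcases Nat.eq_zero_or_pos j with rfl | hj
    · have : i = 0 := by omega
      subst this
      refine ⟨?_, rfl⟩
      rw [hY0, hY0] at h
      apply hs
      apply hcd
      intro p hp
      have := h p hp
      simp only [Prod.mk.injEq] at this
      exact this.1.2
    · obtain ⟨p, x, hp⟩ := hnew α j hj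
      rw [h p.1 p.2] at hp
      have := hent _ _ _ _ _ _ hp
      exact ⟨this.1, by omega⟩
  refine (mkTripath (l := l) (q := q) m (fun α j => ι ∘ X α j) (fun α j => ι ∘ Y α j) ?_ ?_ ?_ ?_ ?_ ?_ ?_).elim
    (fun T hT => ⟨_, T.finite, _, subset_rfl, T, ?_⟩)
  · intro α j _ p hp
    exact congrArg ι (hk α j p hp)
  · intro α j _ h
    exact hne α j (ι.injective.comp_left h)
  · intro α j _
    exact cf_map ι (hcf α j)
  · intro α j β i _ _ h
    have h := hkι _ _ h
    rcases le_total i j with hij | hij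
    · exact hinj _ _ _ _ h hij
    · obtain ⟨h1, h2⟩ := hinj _ _ _ _ (keyEq_symm h) hij
      exact ⟨h1.symm, h2.symm⟩
  · apply solPair_map
    rw [hY0, hY0]
    obtain ⟨μ, h1, h2⟩ := hde
    exact ⟨fun v => ((μ v, r 0 v), none), fun p => by simp [h1, hA, w, s], fun p => by simp [h2, hB, w, s]⟩
  · apply solPair_map
    rw [hY0, hY0]
    obtain ⟨μ, h1, h2⟩ := hef
    refine ⟨fun v => ((μ v, r 1 v), none), fun p => by simp [h1, hA, w, s], fun p => ?_⟩
    simp [h2, hB, w, s]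
    norm_num
  · intro α hsub
    have : ∃ β, keySet l (ι ∘ Y β 0) ⊆ keySet l (ι ∘ Y α (m α)) := by
      rcases gSet_cases (l := l) (ι ∘ Y 1 0) (ι ∘ Y 0 0) (ι ∘ Y 2 0) with h | h | h <;> rw [h] at hsub
      exacts [⟨_, hsub⟩, ⟨_, hsub⟩, ⟨_, hsub⟩]
    obtain ⟨β, hβ⟩ := this
    obtain ⟨p, z, h1, h2, h3⟩ := hgs β
    obtain ⟨p', hp', h⟩ := hβ ⟨p.1, p.2, rfl⟩
    have h := ι.injective h
    refine hend α ⟨p', hp'⟩ ?_ ?_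
    · rw [h, h1, h2]
    · rw [h, h1]; exact h3
  · intro h
    apply hfd
    have h := h.2.2
    rw [hT.1, hT.2.2] at h
    have := solPair_map (fun x => (Function.invFun ι x).1.1) h
    convert this using 1
    · ext p
      have h3 := Function.leftInverse_invFun ι.injective (Y 2 0 p)
      simp only [Function.comp, h3]
      simp [hY0, w]
    · ext p
      have h3 := Function.leftInverse_invFun ι.injective (Y 1 0 p)
      simp only [Function.comp, h3]
      simp [hY0, w]

end CQAP

namespace CQAP
open CQA
variable {n l : ℕ} {Elem Var : Type}

theorem comp_key {q : Query n Var} {D : Set (Fin n → Elem)} {x y z : Fin n → Elem}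
    (hy : y ∈ qComponent l q D x) (hz : z ∈ D) (h : keyEq l y z) : z ∈ qComponent l q D x :=
  ⟨hz, hy.2.trans _ _ _ (.rel _ _ (Or.inl h))⟩

theorem comp_cf {q : Query n Var} {D : Set (Fin n → Elem)} {x y z : Fin n → Elem}
    (hy : y ∈ qComponent l q D x) (hz : z ∈ D) (h : cf q y z) : z ∈ qComponent l q D x :=
  ⟨hz, hy.2.trans _ _ _ (.rel _ _ (Or.inr ⟨y, z, ⟨hy.1, keyEq_refl _⟩, ⟨hz, keyEq_refl _⟩,
    h.imp (fun h => ⟨hy.1, hz, h⟩) (fun h => ⟨hz, hy.1, h⟩)⟩))⟩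

theorem comp_eq {q : Query n Var} {D : Set (Fin n → Elem)} {x y : Fin n → Elem}
    (hy : qConn l q D x y) : qComponent l q D x = qComponent l q D y := by
  ext z
  exact ⟨fun h => ⟨h.1, (hy.symm _ _).trans _ _ _ h.2⟩, fun h => ⟨h.1, hy.trans _ _ _ h.2⟩⟩

theorem comp_tri [Countable Elem] [Infinite Elem] {q : Query n Var} (hq : TwoWayDet l q)
    (hnf : ¬ AdmitsForkTripath l q Elem) {D : Set (Fin n → Elem)} {x0 : Fin n → Elem}
    {Θ : Set (Fin n → Elem)} (hΘ : Θ ⊆ qComponent l q D x0) (T : Tripath l q Θ)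
    {d e f : Fin n → Elem} (hd : d ∈ qComponent l q D x0) (he : e ∈ qComponent l q D x0)
    (hf : f ∈ qComponent l q D x0) (hde : solPair q d e) (hef : solPair q e f) : solPair q f d := by
  have hT : Sol q Θ T.fc T.dc := by
    by_contra h
    exact hnf ⟨Θ, T.finite, Θ, subset_rfl, T, h⟩
  obtain ⟨d', hd', e', he', f', hf', u, hu, h1, h2, h3, k1, k2, k3, hg⟩ := tri_data T hT
  let c : ZMod 3 → Fin n → Elem := (![d', e', f'] : Fin 3 → Fin n → Elem)
  have c0 : c 0 = d' := rfl
  have c1 : c 1 = e' := rfl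
  have c2 : c 2 = f' := rfl
  have h3' : ∀ i : ZMod 3, i = 0 ∨ i = 1 ∨ i = 2 := by decide
  have hc : ∀ i, solPair q (c i) (c (i+1)) := by
    intro i
    rcases h3' i with rfl | rfl | rfl
    exacts [h1, h2, h3]
  have hcC : ∀ i, c i ∈ qComponent l q D x0 := by
    intro i
    rcases h3' i with rfl | rfl | rfl
    exacts [hΘ hd', hΘ he', hΘ hf']
  have hcd : ∀ i j, keyEq l (c i) (c j) → i = j := by
    intro i j h
    rcases h3' i with rfl | rfl | rfl <;> rcases h3' j with rfl | rfl | rfl <;> try rfl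
    · exact absurd h k1
    · exact absurd h k3
    · exact absurd (keyEq_symm h) k1
    · exact absurd h k2
    · exact absurd (keyEq_symm h) k3
    · exact absurd (keyEq_symm h) k2
  have hconn : ∀ x ∈ qComponent l q D x0, ∀ y ∈ qComponent l q D x0, qConn l q D x y :=
    fun x hx y hy => (hx.2.symm _ _).trans _ _ _ hy.2
  have hlost : ∀ i, ∃ p : KP n l, Lost l q c (c i p.1) := by
    intro i
    by_contra hno
    push Not at hno
    have hsub : ∀ x ∈ qComponent l q D x0, keySet l (c i) ⊆ keySet l x := by
      rintro x hx y ⟨p, hp, rfl⟩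
      have := hno ⟨p, hp⟩
      unfold Lost at this
      push Not at this
      obtain ⟨ω, hω, j, hj⟩ := this
      rw [Inv_conn hω _ (hconn _ (hcC j) x hx)] at hj
      exact Inv_ne hj
    apply hg
    refine (gSet_min (S := keySet l (c i)) ?_ (hsub _ (hΘ hd')) (hsub _ (hΘ he')) (hsub _ (hΘ hf'))).trans (hsub _ (hΘ hu))
    rcases h3' i with rfl | rfl | rfl
    exacts [Or.inl rfl, Or.inr (Or.inl rfl), Or.inr (Or.inr rfl)]
  have hgs : ∀ x ∈ qComponent l q D x0, GoodStart l q x := fun x hx =>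
    (GoodStart.conn (hconn _ (hcC 0) x hx)).1 (GoodStart.tri hc 0)
  exact fork_core hq hnf c hc hcd hlost (hgs d hd) (hgs e he) (hgs f hf) hde hef

theorem gsymm {q : Query n Var} {D : Set (Fin n → Elem)} {a b : Fin n → Elem}
    (h : Relation.ReflTransGen (gEdge q D) a b) : Relation.ReflTransGen (gEdge q D) b a := by
  induction h with
  | refl => exact .refl
  | tail _ h ih => exact .head ⟨h.1.symm, h.2.2.1, h.2.1, h.2.2.2.symm⟩ ih

theorem comp_clique {q : Query n Var} (hq : TwoWayDet l q)
    {D : Set (Fin n → Elem)} {x0 : Fin n → Elem}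
    (tri : ∀ d ∈ qComponent l q D x0, ∀ e ∈ qComponent l q D x0, ∀ f ∈ qComponent l q D x0,
      solPair q d e → solPair q e f → solPair q f d)
    {a : Fin n → Elem} (ha : a ∈ qComponent l q D x0) : QuasiClique l q D (gComp q D a) := by
  have main : ∀ a ∈ qComponent l q D x0, ∀ b, Relation.ReflTransGen (gEdge q D) a b →
      b ∈ qComponent l q D x0 ∧ (cf q a b ∨ a = b ∨ (∃ z ∈ qComponent l q D x0, solPair q a z ∧ solPair q b z) ∨
        (∃ z ∈ qComponent l q D x0, solPair q z a ∧ solPair q z b)) := by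
    intro a ha b hab
    induction hab with
    | refl => exact ⟨ha, Or.inr (Or.inl rfl)⟩
    | @tail b c _ hbc ih =>
      obtain ⟨hb, ih⟩ := ih
      have hbc' : cf q b c := hbc.2.2.2.imp (fun h => h.2.2) (fun h => h.2.2)
      have hc := comp_cf hb hbc.2.2.1 hbc'
      refine ⟨hc, ?_⟩
      rcases ih with (h | h) | rfl | ⟨z, hz, h1, h2⟩ | ⟨z, hz, h1, h2⟩
      · rcases hbc' with h' | h'
        · exact Or.inl (Or.inr (tri _ ha _ hb _ hc h h'))
        · exact Or.inr (Or.inr (Or.inl ⟨b, hb, h, h'⟩))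
      · rcases hbc' with h' | h'
        · exact Or.inr (Or.inr (Or.inr ⟨b, hb, h, h'⟩))
        · exact Or.inl (Or.inl (tri _ hc _ hb _ ha h' h))
      · exact Or.inl hbc'
      · rcases hbc' with h' | h'
        · exact Or.inl (Or.inl (zz h1 h2 h'))
        · exact Or.inl (Or.inr (tri _ ha _ hz _ hc h1 (tri _ hc _ hb _ hz h' h2)))
      · rcases hbc' with h' | h'
        · exact Or.inl (Or.inl (tri _ hc _ hz _ ha (tri _ hz _ hb _ hc h2 h') h1))
        · exact Or.inl (Or.inr (zz h' h2 h1))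
  intro x hx y hy hxy
  have hsym : Relation.ReflTransGen (gEdge q D) x a :=
    gsymm hx.2
  obtain ⟨hxC, _⟩ := main a ha x hx.2
  obtain ⟨_, h | rfl | ⟨z, _, h1, h2⟩ | ⟨z, _, h1, h2⟩⟩ := main x hxC y (hsym.trans hy.2)
  · exact h.imp (fun h => ⟨hx.1, hy.1, h⟩) (fun h => ⟨hy.1, hx.1, h⟩)
  · exact absurd (keyEq_refl _) hxy
  · exact absurd (det_in hq h1 h2) hxy
  · exact absurd (det_out hq h1 h2) hxy

theorem gComp_eq {q : Query n Var} {D : Set (Fin n → Elem)} {a b : Fin n → Elem}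
    (h : Relation.ReflTransGen (gEdge q D) a b) : gComp q D a = gComp q D b := by
  have h' : Relation.ReflTransGen (gEdge q D) b a :=
    gsymm h
  ext z
  exact ⟨fun hz => ⟨hz.1, h'.trans hz.2⟩, fun hz => ⟨hz.1, h.trans hz.2⟩⟩

theorem comp_match {q : Query n Var} {D : Set (Fin n → Elem)} {x0 : Fin n → Elem}
    (hcl : ∀ a ∈ qComponent l q D x0, QuasiClique l q D (gComp q D a))
    (hM : SaturatingMatching l q D) :
    ∃ r ⊆ qComponent l q D x0, Consistent l r ∧ (∀ x ∈ qComponent l q D x0, cov l r x) ∧ ¬ Sat q r := by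
  classical
  obtain ⟨M, hM1, hM2⟩ := hM
  have hsel : ∀ B : {B : Set (Fin n → Elem) // ∃ x ∈ D, B = Block l D x}, ∃ a ∈ B.1, a ∈ M B.1 ∧ ¬ Sol q D a a := by
    rintro ⟨_, x, hx, rfl⟩
    exact (hM1 x hx).2.2
  choose sel s1 s2 s3 using hsel
  let sl : ∀ y, y ∈ D → (Fin n → Elem) := fun y hy => sel ⟨Block l D y, y, hy, rfl⟩
  have t1 : ∀ y hy, sl y hy ∈ D ∧ keyEq l y (sl y hy) := fun y hy => s1 ⟨Block l D y, y, hy, rfl⟩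
  have t2 : ∀ y hy, sl y hy ∈ M (Block l D y) := fun y hy => s2 ⟨Block l D y, y, hy, rfl⟩
  have t3 : ∀ y hy, ¬ Sol q D (sl y hy) (sl y hy) := fun y hy => s3 ⟨Block l D y, y, hy, rfl⟩
  have t4 : ∀ y hy z hz, Block l D y = Block l D z → sl y hy = sl z hz := by
    intro y hy z hz h
    simp only [sl, h]
  have t5 : ∀ y (hy : y ∈ qComponent l q D x0), sl y hy.1 ∈ qComponent l q D x0 := fun y hy =>
    comp_key hy (t1 y hy.1).1 (t1 y hy.1).2
  have t6 : ∀ y (hy : y ∈ qComponent l q D x0), M (Block l D y) = gComp q D (sl y hy.1) := by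
    intro y hy
    obtain ⟨z, hz, h⟩ := (hM1 y hy.1).2.1
    have h2 := t2 y hy.1
    rw [h] at h2 ⊢
    unfold cliqueOf at h2 ⊢
    split_ifs at h2 ⊢ with hQ
    · exact gComp_eq h2.2
    · have h2 : sl y hy.1 = z := h2
      exact absurd (h2 ▸ hcl _ (t5 y hy)) hQ
  refine ⟨{a | ∃ y, ∃ hy : y ∈ qComponent l q D x0, a = sl y hy.1}, ?_, ?_, ?_, ?_⟩
  · rintro a ⟨y, hy, rfl⟩
    exact t5 y hy
  · rintro a ⟨y, hy, rfl⟩ b ⟨z, hz, rfl⟩ h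
    refine t4 y hy.1 z hz.1 ?_
    exact block_congr (keyEq_trans (keyEq_trans (t1 y hy.1).2 h) (keyEq_symm (t1 z hz.1).2))
  · intro x hx
    exact ⟨_, ⟨x, hx, rfl⟩, (t1 x hx.1).2⟩
  · rintro ⟨a, b, ⟨y, hy, rfl⟩, ⟨z, hz, rfl⟩, h⟩
    by_cases hab : sl y hy.1 = sl z hz.1
    · apply t3 y hy.1
      refine ⟨(t1 y hy.1).1, (t1 y hy.1).1, ?_⟩
      rw [← hab] at h; exact h
    · apply hab
      refine t4 y hy.1 z hz.1 ?_
      apply hM2 _ hy.1 _ hz.1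
      rw [t6 y hy, t6 z hz]
      apply gComp_eq
      exact .single ⟨hab, (t1 y hy.1).1, (t1 z hz.1).1, Or.inl ⟨(t1 y hy.1).1, (t1 z hz.1).1, h⟩⟩

theorem delta_closed {k : ℕ} {q : Query n Var} {D : Set (Fin n → Elem)} :
    DeltaClosed l k q D (Delta l k q D) := by
  constructor
  · intro S h1 h2 𝒮 h
    exact h.1 S h1 h2
  · rintro S h1 ⟨x, hx, h2⟩ 𝒮 h
    refine h.2 S h1 ⟨x, hx, fun u hu hk => ?_⟩
    obtain ⟨S', a, b, c⟩ := h2 u hu hk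
    exact ⟨S', a, b, c 𝒮 h⟩

theorem main_iff (n l : ℕ) 
    (Elem Var : Type) [Countable Elem] [Infinite Elem] 
    (q : CQA.Query n Var) (hq : CQA.TwoWayDet l q)
    (hnf : ¬ CQA.AdmitsForkTripath l q Elem)
    (D : Set (Fin n → Elem)) (hD : D.Finite) :
    CQA.Certain l q D ↔
      (∅ ∈ CQA.Delta l (2 ^ (2 * l ^ l + 1) + l ^ l - 1) q D ∨
        ¬ CQA.SaturatingMatching l q D) := by
  classical
  constructor
  swap
  · rintro (h | h)
    · exact delta_sound h
    · exact matching_sound h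
  intro hcert
  by_contra hno
  push Not at hno
  obtain ⟨hΔ, hM⟩ := hno
  set k := 2 ^ (2 * l ^ l + 1) + l ^ l - 1 with hk
  have hcomp : ∀ x ∈ D, ∃ r ⊆ qComponent l q D x, Consistent l r ∧
      (∀ y ∈ qComponent l q D x, cov l r y) ∧ ¬ Sat q r := by
    intro x hx
    by_cases htp : ∀ Θ ⊆ qComponent l q D x, Tripath l q Θ → False
    · refine partE (𝒢 := {S | kSet l k D S ∧ S ∉ Delta l k q D}) (hD.subset fun y hy => hy.1) hq ?_ ?_ ?_ ?_ htp
      · exact ⟨⟨by simp, by simp, by simp, fun a ha => absurd ha (by simp)⟩, hΔ⟩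
      · rintro S ⟨hS, hS'⟩ T hT
        have hTk : kSet l k D T := ⟨hT.trans hS.1, hS.2.1.subset hT,
          (Set.ncard_le_ncard hT hS.2.1).trans hS.2.2.1, fun a ha b hb => hS.2.2.2 a (hT ha) b (hT hb)⟩
        refine ⟨hTk, fun h => hS' ?_⟩
        exact delta_closed.2 S hS ⟨x, hx, fun u _ _ => ⟨T, hT.trans Set.subset_union_left, hTk, h⟩⟩
      · rintro S ⟨hS, hS'⟩ h
        exact hS' (delta_closed.1 S hS h)
      · rintro S ⟨hS, hS'⟩ hfin hcard y hy hcov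
        by_contra hc
        push Not at hc
        apply hS'
        refine delta_closed.2 S hS ⟨y, hy.1, fun u hu hyu => ⟨insert u S, by rw [Set.union_singleton], ?_⟩⟩
        have hks : kSet l k D (insert u S) := by
          refine ⟨Set.insert_subset hu hS.1, hfin.insert _, (Set.ncard_insert_le _ _).trans hcard, ?_⟩
          rintro a (rfl | ha) b (rfl | hb) hab
          · rfl
          · exact absurd ⟨b, hb, keyEq_trans hyu hab⟩ hcov
          · exact absurd ⟨a, ha, keyEq_trans hyu (keyEq_symm hab)⟩ hcov
          · exact hS.2.2.2 a ha b hb hab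
        refine ⟨hks, ?_⟩
        by_contra hd
        exact hc u (comp_key hy hu hyu) hyu ⟨hks, hd⟩
    · push Not at htp
      obtain ⟨Θ, hΘ, T, _⟩ := htp
      refine comp_match (fun a ha => comp_clique hq ?_ ha) hM
      intro d hd e he f hf
      exact comp_tri hq hnf hΘ T hd he hf
  have hcomp' : ∀ C : Set (Fin n → Elem), ∃ r, (∃ x ∈ D, C = qComponent l q D x) → r ⊆ C ∧ Consistent l r ∧
      (∀ y ∈ C, cov l r y) ∧ ¬ Sat q r := by
    intro C
    by_cases h : ∃ x ∈ D, C = qComponent l q D x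
    · obtain ⟨x, hx, rfl⟩ := h
      obtain ⟨r, h⟩ := hcomp x hx
      exact ⟨r, fun _ => h⟩
    · exact ⟨∅, fun h' => absurd h' h⟩
  choose R hR using hcomp'
  have hR' : ∀ x ∈ D, _ := fun x hx => hR (qComponent l q D x) ⟨x, hx, rfl⟩
  have hself : ∀ x ∈ D, x ∈ qComponent l q D x := fun x hx => ⟨hx, .refl _⟩
  have hsame : ∀ x ∈ D, ∀ y ∈ D, ∀ a ∈ R (qComponent l q D x), ∀ b ∈ R (qComponent l q D y),
      (keyEq l a b ∨ cf q a b) → qComponent l q D x = qComponent l q D y := by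
    intro x hx y hy a ha b hb h
    have ha' := (hR' x hx).1 ha
    have hb' := (hR' y hy).1 hb
    have hbx : b ∈ qComponent l q D x := by
      rcases h with h | h
      · exact comp_key ha' hb'.1 h
      · exact comp_cf ha' hb'.1 h
    rw [comp_eq hbx.2, comp_eq hb'.2]
  have hrep : Repair l D {a | ∃ x ∈ D, a ∈ R (qComponent l q D x)} := by
    refine repair_of ?_ ?_ ?_
    · rintro a ⟨x, hx, ha⟩
      exact ((hR' x hx).1 ha).1
    · rintro a ⟨x, hx, ha⟩ b ⟨y, hy, hb⟩ h
      have := hsame x hx y hy a ha b hb (Or.inl h)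
      rw [← this] at hb
      exact (hR' x hx).2.1 a ha b hb h
    · intro x hx
      obtain ⟨b, hb, h⟩ := (hR' x hx).2.2.1 x (hself x hx)
      exact ⟨b, ⟨x, hx, hb⟩, h⟩
  obtain ⟨a, b, ⟨x, hx, ha⟩, ⟨y, hy, hb⟩, h⟩ := hcert _ hrep
  have := hsame x hx y hy a ha b hb (Or.inr (Or.inl h))
  rw [← this] at hb
  exact (hR' x hx).2.2.2 ⟨a, b, ha, hb, h⟩

end CQAP

/-- for a 2way-determined query without fork-tripath, certainty equals the
disjunction of the greedy fixpoint algorithm (at `k = 2^(2κ+1)+κ-1`, `κ = l^l`) and the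
failure of a saturating matching. -/
theorem no_fork_certain_iff (n l : ℕ) (hn : 1 ≤ n) (hl : l ≤ n)
    (Elem Var : Type) [Countable Elem] [Infinite Elem] [Countable Var] [Infinite Var]
    (q : CQA.Query n Var) (hq : CQA.TwoWayDet l q)
    (hnf : ¬ CQA.AdmitsForkTripath l q Elem)
    (D : Set (Fin n → Elem)) (hD : D.Finite) :
    CQA.Certain l q D ↔
      (∅ ∈ CQA.Delta l (2 ^ (2 * l ^ l + 1) + l ^ l - 1) q D ∨
        ¬ CQA.SaturatingMatching l q D) := by
  exact CQAP.main_iff n l Elem Var q hq hnf D hD
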